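/- Let p_{Y1,Y2|X} be a discrete memoryless broadcast channel with finite alphabets and capacities C_i := C(p_{Y_i|X}) > 0 (i=1,2), and let d_1, d_2 ∈ [0,1/2). Define κ* := min{κ ≥ 0 : 𝒞(BS-BC(d_1,d_2)) ⊆ κ·𝒞₁(p_{Y1,Y2|X})} if d_1 ≤ d_2, and κ* := min{κ ≥ 0 : 𝒞(BS-BC(d_1,d_2)) ⊆ κ·𝒞₂(p_{Y1,Y2|X})} if d_1 ≥ d_2; and κ† := max{(1−H_b(d_1))/C_1, (1−H_b(d_2))/C_2}. If d_1 ≤ d_2, then κ* = κ† = (1−H_b(d_1))/C_1 whenever (1−2d_1)²/(1−2d_2)² ≥ C_1/C_2, and κ* = κ† = (1−H_b(d_2))/C_2 whenever ((1−2d_1)·log₂((1−d_1)/d_1))/((1−2d_2)·log₂((1−d_2)/d_2)) ≤ C_1/C_2. Symmetrically, if d_1 ≥ d_2, then κ* = κ† = (1−H_b(d_2))/C_2 whenever (1−2d_2)²/(1−2d_1)² ≥ C_2/C_1, and κ* = κ† = (1−H_b(d_1))/C_1 whenever ((1−2d_2)·log₂((1−d_2)/d_2))/((1−2d_1)·log₂((1−d_1)/d_1))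 ≤ C_2/C_1. -/

import Mathlib

open scoped BigOperators Classical
open Finset

noncomputable section

/-- `p` is a probability mass function on the finite type `α`. -/
def IsPMF {α : Type} [Fintype α] (p : α → ℝ) : Prop :=
  (∀ a, 0 ≤ p a) ∧ ∑ a, p a = 1

/-- Shannon entropy (base 2) of a pmf on a finite type. -/
def Hent {α : Type} [Fintype α] (p : α → ℝ) : ℝ :=
  -∑ a, p a * Real.logb 2 (p a)

/-- Mutual information `I(A;B)` of a joint pmf on `α × β` (base-2 logarithms). -/
def MI {α β : Type} [Fintype α] [Fintype β] (p : α × β → ℝ) : ℝ :=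
  Hent (fun a => ∑ b, p (a, b)) + Hent (fun b => ∑ a, p (a, b)) - Hent p

/-- Conditional mutual information `I(A;B|C)` of a joint pmf on `α × β × γ`. -/
def CMI {α β γ : Type} [Fintype α] [Fintype β] [Fintype γ] (p : α × β × γ → ℝ) : ℝ :=
  Hent (fun ac : α × γ => ∑ b, p (ac.1, b, ac.2))
    + Hent (fun bc : β × γ => ∑ a, p (a, bc.1, bc.2))
    - Hent p
    - Hent (fun c : γ => ∑ a, ∑ b, p (a, b, c))

/-- A channel: every input letter gives a pmf on outputs. -/
def IsChannel {X Z : Type} [Fintype Z] (W : X → Z → ℝ) : Prop :=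
  ∀ x, IsPMF (W x)

/-- Marginal channel to receiver 1 of a broadcast channel. -/
def margW1 {X Y1 Y2 : Type} [Fintype Y2] (W : X → Y1 × Y2 → ℝ) : X → Y1 → ℝ :=
  fun x y1 => ∑ y2, W x (y1, y2)

/-- Marginal channel to receiver 2 of a broadcast channel. -/
def margW2 {X Y1 Y2 : Type} [Fintype Y1] (W : X → Y1 × Y2 → ℝ) : X → Y2 → ℝ :=
  fun x y2 => ∑ y1, W x (y1, y2)

/-- Memoryless `n`-fold extension of a broadcast channel. -/
def nFold {X Y1 Y2 : Type} (W : X → Y1 × Y2 → ℝ) (n : ℕ)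
    (x : Fin n → X) (y : (Fin n → Y1) × (Fin n → Y2)) : ℝ :=
  ∏ t, W (x t) (y.1 t, y.2 t)

section Channel

variable {X Y1 Y2 : Type} [Fintype Y1] [Fintype Y2]

/-- Average error probability; message `M2` known at receiver 1. -/
def errP1 (W : X → Y1 × Y2 → ℝ) (n k1 k2 : ℕ) (f : Fin k1 × Fin k2 → Fin n → X)
    (g1 : (Fin n → Y1) × Fin k2 → Fin k1) (g2 : (Fin n → Y2) → Fin k2) : ℝ :=
  (1 : ℝ) / ((k1 : ℝ) * (k2 : ℝ)) *
    ∑ m : Fin k1 × Fin k2, ∑ y : (Fin n → Y1) × (Fin n → Y2),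
      nFold W n (f m) y * (if g1 (y.1, m.2) = m.1 ∧ g2 y.2 = m.2 then 0 else 1)

/-- Average error probability; message `M1` known at receiver 2. -/
def errP2 (W : X → Y1 × Y2 → ℝ) (n k1 k2 : ℕ) (f : Fin k1 × Fin k2 → Fin n → X)
    (g1 : (Fin n → Y1) → Fin k1) (g2 : (Fin n → Y2) × Fin k1 → Fin k2) : ℝ :=
  (1 : ℝ) / ((k1 : ℝ) * (k2 : ℝ)) *
    ∑ m : Fin k1 × Fin k2, ∑ y : (Fin n → Y1) × (Fin n → Y2),
      nFold W n (f m) y * (if g1 y.1 = m.1 ∧ g2 (y.2, m.1) = m.2 then 0 else 1)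

/-- Average error probability; no receiver side information. -/
def errP0 (W : X → Y1 × Y2 → ℝ) (n k1 k2 : ℕ) (f : Fin k1 × Fin k2 → Fin n → X)
    (g1 : (Fin n → Y1) → Fin k1) (g2 : (Fin n → Y2) → Fin k2) : ℝ :=
  (1 : ℝ) / ((k1 : ℝ) * (k2 : ℝ)) *
    ∑ m : Fin k1 × Fin k2, ∑ y : (Fin n → Y1) × (Fin n → Y2),
      nFold W n (f m) y * (if g1 y.1 = m.1 ∧ g2 y.2 = m.2 then 0 else 1)

/-- Achievability of a rate pair with `M2` available at receiver 1. -/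
def Ach1 (W : X → Y1 × Y2 → ℝ) (R : ℝ × ℝ) : Prop :=
  0 ≤ R.1 ∧ 0 ≤ R.2 ∧ ∀ ε : ℝ, 0 < ε →
    ∃ (n k1 k2 : ℕ), 0 < n ∧ 0 < k1 ∧ 0 < k2 ∧
      ∃ (f : Fin k1 × Fin k2 → Fin n → X) (g1 : (Fin n → Y1) × Fin k2 → Fin k1)
        (g2 : (Fin n → Y2) → Fin k2),
        R.1 ≤ Real.logb 2 (k1 : ℝ) / (n : ℝ) ∧ R.2 ≤ Real.logb 2 (k2 : ℝ) / (n : ℝ) ∧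
        errP1 W n k1 k2 f g1 g2 ≤ ε

/-- Achievability of a rate pair with `M1` available at receiver 2. -/
def Ach2 (W : X → Y1 × Y2 → ℝ) (R : ℝ × ℝ) : Prop :=
  0 ≤ R.1 ∧ 0 ≤ R.2 ∧ ∀ ε : ℝ, 0 < ε →
    ∃ (n k1 k2 : ℕ), 0 < n ∧ 0 < k1 ∧ 0 < k2 ∧
      ∃ (f : Fin k1 × Fin k2 → Fin n → X) (g1 : (Fin n → Y1) → Fin k1)
        (g2 : (Fin n → Y2) × Fin k1 → Fin k2),
        R.1 ≤ Real.logb 2 (k1 : ℝ) / (n : ℝ) ∧ R.2 ≤ Real.logb 2 (k2 : ℝ) / (n : ℝ) ∧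
        errP2 W n k1 k2 f g1 g2 ≤ ε

/-- Achievability of a rate pair with no receiver side information. -/
def Ach0 (W : X → Y1 × Y2 → ℝ) (R : ℝ × ℝ) : Prop :=
  0 ≤ R.1 ∧ 0 ≤ R.2 ∧ ∀ ε : ℝ, 0 < ε →
    ∃ (n k1 k2 : ℕ), 0 < n ∧ 0 < k1 ∧ 0 < k2 ∧
      ∃ (f : Fin k1 × Fin k2 → Fin n → X) (g1 : (Fin n → Y1) → Fin k1)
        (g2 : (Fin n → Y2) → Fin k2),
        R.1 ≤ Real.logb 2 (k1 : ℝ) / (n : ℝ) ∧ R.2 ≤ Real.logb 2 (k2 : ℝ) / (n : ℝ) ∧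
        errP0 W n k1 k2 f g1 g2 ≤ ε

/-- Capacity region `𝒞₁`: side information `M2` at receiver 1. -/
def Cap1 (W : X → Y1 × Y2 → ℝ) : Set (ℝ × ℝ) := closure {R | Ach1 W R}

/-- Capacity region `𝒞₂`: side information `M1` at receiver 2. -/
def Cap2 (W : X → Y1 × Y2 → ℝ) : Set (ℝ × ℝ) := closure {R | Ach2 W R}

/-- Private-message capacity region `𝒞`. -/
def Cap (W : X → Y1 × Y2 → ℝ) : Set (ℝ × ℝ) := closure {R | Ach0 W R}

end Channel

/-- `κ·𝒜` for a set of rate pairs. -/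
def scaleSet (κ : ℝ) (A : Set (ℝ × ℝ)) : Set (ℝ × ℝ) :=
  (fun R : ℝ × ℝ => (κ * R.1, κ * R.2)) '' A

/-- Binary entropy function (base 2). -/
def Hb (x : ℝ) : ℝ := -(x * Real.logb 2 x) - (1 - x) * Real.logb 2 (1 - x)

/-- Binary convolution `a*b = a(1-b)+(1-a)b`. -/
def bconv (a b : ℝ) : ℝ := a * (1 - b) + (1 - a) * b

/-- The region `𝒞(BS-BC(d₁,d₂))`. -/
def CBSBC (d1 d2 : ℝ) : Set (ℝ × ℝ) :=
  {R | 0 ≤ R.1 ∧ 0 ≤ R.2 ∧ ∃ α ∈ Set.Icc (0:ℝ) (1/2),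
    R.1 ≤ Hb (bconv α d1) - Hb d1 ∧ R.2 ≤ 1 - Hb (bconv α d2)}

/-- The region `𝒞(BE-BC(ε₁,ε₂))`. -/
def CBEBC (e1 e2 : ℝ) : Set (ℝ × ℝ) :=
  {R | 0 ≤ R.1 ∧ 0 ≤ R.2 ∧ ∃ β ∈ Set.Icc (0:ℝ) 1,
    R.1 ≤ β * (1 - e1) ∧ R.2 ≤ (1 - β) * (1 - e2)}

/-- 1-norm distance between two functions on a finite type. -/
def l1dist {α : Type} [Fintype α] (p q : α → ℝ) : ℝ := ∑ a, |p a - q a|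

/-- Capacity `C(p_{Y|X}) = max_{p_X} I(X;Y)` of a point-to-point channel. -/
def Cmarg {X Y : Type} [Fintype X] [Fintype Y] (Wm : X → Y → ℝ) : ℝ :=
  sSup {r | ∃ pX : X → ℝ, IsPMF pX ∧ r = MI (fun a : X × Y => pX a.1 * Wm a.1 a.2)}

/-- `(1-2d)·log₂((1-d)/d)`. -/
def lrf (d : ℝ) : ℝ := (1 - 2*d) * Real.logb 2 ((1 - d) / d)

/-- The condition `lrf dn / lrf dd ≤ c`, with the quotient interpreted as `1`
when `dn = dd = 0` (and as `+∞`, i.e. the condition failing, when only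
`dn = 0`). -/
def lrRatioLe (dn dd c : ℝ) : Prop :=
  if dn = 0 then (if dd = 0 then (1:ℝ) ≤ c else False) else lrf dn / lrf dd ≤ c

lemma sum_prod_pi {ι A : Type} [Fintype ι] [DecidableEq ι] [Fintype A] (h : ι → A → ℝ) :
    ∑ c : ι → A, ∏ i, h i (c i) = ∏ i, ∑ a, h i a := by
  rw [Finset.prod_univ_sum, Fintype.piFinset_univ]

lemma sum_prod_two {ι A : Type} [Fintype ι] [DecidableEq ι] [Fintype A] (h : ι → A → ℝ)
    (hs : ∀ i, ∑ a, h i a = 1) (m m' : ι) (hm : m ≠ m') (F G : A → ℝ) :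
    ∑ c : ι → A, (∏ i, h i (c i)) * (F (c m) * G (c m'))
      = (∑ a, h m a * F a) * (∑ a, h m' a * G a) := by
  have h1 : ∀ c : ι → A, (∏ i, h i (c i)) * (F (c m) * G (c m'))
      = ∏ i, (h i (c i) * (if i = m then F (c i) else 1) * (if i = m' then G (c i) else 1)) := by
    intro c
    rw [Finset.prod_mul_distrib, Finset.prod_mul_distrib]
    simp [mul_assoc]
  simp_rw [h1]
  rw [sum_prod_pi (fun i a => h i a * (if i = m then F a else 1) * (if i = m' then G a else 1))]
  have h2 : ∀ i, ∑ a, h i a * (if i = m then F a else 1) * (if i = m' then G a else 1)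
      = (if i = m then (∑ a, h i a * F a) else 1) * (if i = m' then (∑ a, h i a * G a) else 1) := by
    intro i
    by_cases h3 : i = m
    · subst h3; simp [hm]
    · by_cases h4 : i = m'
      · subst h4; simp [h3]
      · simp [h3, h4, hs]
  simp_rw [h2]
  rw [Finset.prod_mul_distrib]
  simp

lemma sum_prod_one {ι A : Type} [Fintype ι] [DecidableEq ι] [Fintype A] (h : ι → A → ℝ)
    (hs : ∀ i, ∑ a, h i a = 1) (m : ι) (F : A → ℝ) :
    ∑ c : ι → A, (∏ i, h i (c i)) * F (c m) = ∑ a, h m a * F a := by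
  have h1 : ∀ c : ι → A, (∏ i, h i (c i)) * F (c m)
      = ∏ i, (h i (c i) * (if i = m then F (c i) else 1)) := by
    intro c
    rw [Finset.prod_mul_distrib]
    simp
  simp_rw [h1]
  rw [sum_prod_pi (fun i a => h i a * (if i = m then F a else 1))]
  have h2 : ∀ i, ∑ a, h i a * (if i = m then F a else 1)
      = (if i = m then (∑ a, h i a * F a) else 1) := by
    intro i
    by_cases h3 : i = m
    · subst h3; simp
    · simp [h3, hs]
  simp_rw [h2]
  simp

lemma exists_le_of_avg {C : Type} [Fintype C] (w e : C → ℝ) (r : ℝ) (hw : ∀ c, 0 ≤ w c)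
    (hs : ∑ c, w c = 1) (h : ∑ c, w c * e c ≤ r) : ∃ c, e c ≤ r := by
  by_contra hc
  push Not at hc
  have h0 : ∑ c, w c * (e c - r) ≤ 0 := by
    have : ∑ c, w c * (e c - r) = ∑ c, w c * e c - (∑ c, w c) * r := by
      rw [Finset.sum_mul, ← Finset.sum_sub_distrib]
      exact Finset.sum_congr rfl fun c _ => by ring
    rw [this, hs]; linarith
  have h1 : ∀ c ∈ (Finset.univ : Finset C), 0 ≤ w c * (e c - r) := fun c _ =>
    mul_nonneg (hw c) (by linarith [hc c])
  have h2 := (Finset.sum_eq_zero_iff_of_nonneg h1).1 (le_antisymm h0 (Finset.sum_nonneg h1))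
  have h3 : ∀ c, w c = 0 := fun c => by
    rcases mul_eq_zero.1 (h2 c (Finset.mem_univ c)) with h | h
    · exact h
    · linarith [hc c]
  simp [h3] at hs

/-- One-shot random coding bound (dependence testing bound). -/
lemma oneshot {A B : Type} [Fintype A] [Fintype B] (P : A → ℝ) (hP : IsPMF P)
    (V : A → B → ℝ) (hV : IsChannel V) (M : ℕ) (hM : 0 < M) :
    ∃ (c : Fin M → A) (g : B → Fin M),
      (1 / (M : ℝ)) * ∑ m, ∑ b, V (c m) b * (if g b = m then 0 else 1)
        ≤ ∑ a, ∑ b, P a * min (V a b) (M * ∑ a', P a' * V a' b) := by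
  set q : B → ℝ := fun b => ∑ a', P a' * V a' b with hq
  let g : (Fin M → A) → B → Fin M := fun c b =>
    if h : ∃ m, M * q b < V (c m) b then h.choose else ⟨0, hM⟩
  have hM' : (0:ℝ) < M := by exact_mod_cast hM
  have key : ∀ (c : Fin M → A) (m : Fin M) (b : B),
      (if g c b = m then (0:ℝ) else 1) ≤ (if V (c m) b ≤ M * q b then 1 else 0)
        + ∑ m' ∈ Finset.univ.erase m, (if M * q b < V (c m') b then 1 else 0) := by
    intro c m b
    have hnn : (0:ℝ) ≤ ∑ m' ∈ Finset.univ.erase m, (if M * q b < V (c m') b then 1 else 0) :=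
      Finset.sum_nonneg fun _ _ => by split_ifs <;> norm_num
    by_cases h1 : g c b = m
    · rw [if_pos h1]
      have : (0:ℝ) ≤ (if V (c m) b ≤ M * q b then 1 else 0) := by split_ifs <;> norm_num
      linarith
    · rw [if_neg h1]
      by_cases h2 : V (c m) b ≤ M * q b
      · rw [if_pos h2]; linarith
      · have h3 : ∃ m, M * q b < V (c m) b := ⟨m, not_le.1 h2⟩
        have h4 : g c b = h3.choose := dif_pos h3
        have h5 : M * q b < V (c (g c b)) b := by rw [h4]; exact h3.choose_spec
        rw [if_neg h2, zero_add]
        refine le_trans (le_of_eq ?_) (Finset.single_le_sum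
          (f := fun m' => if M * q b < V (c m') b then (1:ℝ) else 0)
          (fun _ _ => by split_ifs <;> norm_num)
          (Finset.mem_erase.2 ⟨h1, Finset.mem_univ _⟩))
        simp [h5]
  have hsum : ∑ c : Fin M → A, (∏ i, P (c i)) = 1 := by
    rw [sum_prod_pi (fun _ a => P a)]; simp [hP.2]
  have hmsg : ∀ m : Fin M, ∑ c : Fin M → A, (∏ i, P (c i)) *
      ∑ b, V (c m) b * (if g c b = m then 0 else 1)
        ≤ ∑ a, ∑ b, P a * min (V a b) (M * q b) := by
    intro m
    have hV0 : ∀ a b, 0 ≤ V a b := fun a => (hV a).1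
    have step1 : ∑ c : Fin M → A, (∏ i, P (c i)) * ∑ b, V (c m) b * (if g c b = m then 0 else 1)
        ≤ ∑ b, (∑ c : Fin M → A, (∏ i, P (c i)) *
              (V (c m) b * (if V (c m) b ≤ M * q b then 1 else 0))
          + ∑ m' ∈ Finset.univ.erase m, ∑ c : Fin M → A, (∏ i, P (c i)) *
              (V (c m) b * (if M * q b < V (c m') b then 1 else 0))) := by
      calc _ ≤ ∑ c : Fin M → A, ∑ b, ((∏ i, P (c i)) *
              (V (c m) b * (if V (c m) b ≤ M * q b then 1 else 0))
          + ∑ m' ∈ Finset.univ.erase m, (∏ i, P (c i)) *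
              (V (c m) b * (if M * q b < V (c m') b then 1 else 0))) := by
            refine Finset.sum_le_sum fun c _ => ?_
            rw [Finset.mul_sum]
            refine Finset.sum_le_sum fun b _ => ?_
            rw [← Finset.mul_sum, ← Finset.mul_sum, ← mul_add, ← mul_add]
            exact mul_le_mul_of_nonneg_left (mul_le_mul_of_nonneg_left (key c m b) (hV0 _ _))
              (Finset.prod_nonneg fun i _ => hP.1 _)
        _ = _ := by
            rw [Finset.sum_comm]
            refine Finset.sum_congr rfl fun b _ => ?_
            rw [Finset.sum_add_distrib]
            congr 1
            rw [Finset.sum_comm]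
    refine step1.trans ?_
    rw [Finset.sum_comm (f := fun a b => P a * min (V a b) (M * q b))]
    refine Finset.sum_le_sum fun b _ => ?_
    rw [sum_prod_one (fun _ a => P a) (fun _ => hP.2) m
      (fun a => V a b * (if V a b ≤ M * q b then 1 else 0))]
    have h2 : ∀ m' ∈ Finset.univ.erase m, ∑ c : Fin M → A, (∏ i, P (c i)) *
              (V (c m) b * (if M * q b < V (c m') b then 1 else 0))
          = q b * ∑ a, P a * (if M * q b < V a b then 1 else 0) := by
      intro m' hm'
      rw [sum_prod_two (fun _ a => P a) (fun _ => hP.2) m m' (Finset.ne_of_mem_erase hm').symm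
        (fun a => V a b) (fun a => if M * q b < V a b then 1 else 0)]
    rw [Finset.sum_congr rfl h2, Finset.sum_const, nsmul_eq_mul]
    have hq0 : 0 ≤ q b := Finset.sum_nonneg fun a _ => mul_nonneg (hP.1 a) (hV0 a b)
    have h3 : ((Finset.univ.erase m).card : ℝ) ≤ M := by
      have := Finset.card_le_univ (Finset.univ.erase m)
      rw [Fintype.card_fin] at this
      exact_mod_cast this
    have h4 : (0:ℝ) ≤ ∑ a, P a * (if M * q b < V a b then 1 else 0) :=
      Finset.sum_nonneg fun a _ => mul_nonneg (hP.1 a) (by split_ifs <;> norm_num)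
    calc _ ≤ ∑ a, P a * (V a b * (if V a b ≤ M * q b then 1 else 0)) +
          M * (q b * ∑ a, P a * (if M * q b < V a b then 1 else 0)) := by
          gcongr
      _ = ∑ a, P a * min (V a b) (M * q b) := by
          generalize q b = z
          rw [Finset.mul_sum, Finset.mul_sum, ← Finset.sum_add_distrib]
          refine Finset.sum_congr rfl fun a _ => ?_
          by_cases h : V a b ≤ M * z
          · rw [if_pos h, if_neg (not_lt.2 h), min_eq_left h]; ring
          · rw [if_neg h, if_pos (not_le.1 h), min_eq_right (not_le.1 h).le]; ring
      _ ≤ _ := le_rfl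
  obtain ⟨c, hc⟩ := exists_le_of_avg (fun c : Fin M → A => ∏ i, P (c i))
    (fun c => (1 / (M : ℝ)) * ∑ m, ∑ b, V (c m) b * (if g c b = m then 0 else 1))
    (∑ a, ∑ b, P a * min (V a b) (M * q b))
    (fun c => Finset.prod_nonneg fun i _ => hP.1 _) hsum (by
      have : ∑ c : Fin M → A, (∏ i, P (c i)) *
          ((1 / (M : ℝ)) * ∑ m, ∑ b, V (c m) b * (if g c b = m then 0 else 1))
          = (1 / (M:ℝ)) * ∑ m, ∑ c : Fin M → A, (∏ i, P (c i)) *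
              ∑ b, V (c m) b * (if g c b = m then 0 else 1) := by
        rw [Finset.sum_comm, Finset.mul_sum]
        refine Finset.sum_congr rfl fun c _ => ?_
        rw [← Finset.mul_sum]; ring
      rw [this]
      calc _ ≤ (1 / (M:ℝ)) * ∑ m : Fin M, ∑ a, ∑ b, P a * min (V a b) (M * q b) := by
            gcongr with m _
            exact hmsg m
        _ = _ := by
            rw [Finset.sum_const, Finset.card_univ, Fintype.card_fin, nsmul_eq_mul]
            field_simp)
  exact ⟨c, g c, hc⟩

/-- Single-letter form of mutual information. -/
lemma MI_eq {A B : Type} [Fintype A] [Fintype B] (P : A → ℝ) (V : A → B → ℝ)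
    (hV : IsChannel V) :
    MI (fun a : A × B => P a.1 * V a.1 a.2) * Real.log 2
      = ∑ a, ∑ b, P a * V a b * (Real.log (V a b) - Real.log (∑ a', P a' * V a' b)) := by
  have hl : Real.log 2 ≠ 0 := (Real.log_pos one_lt_two).ne'
  have hH : ∀ {C : Type} [Fintype C] (r : C → ℝ),
      Hent r * Real.log 2 = - ∑ c, r c * Real.log (r c) := by
    intro C _ r
    unfold Hent
    rw [neg_mul, Finset.sum_mul]
    congr 1
    refine Finset.sum_congr rfl fun c _ => ?_
    rw [Real.logb]; field_simp
  unfold MI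
  rw [sub_mul, add_mul, hH, hH, hH]
  simp only [Fintype.sum_prod_type]
  have h1 : ∀ a, ∑ b, P a * V a b = P a := fun a => by rw [← Finset.mul_sum, (hV a).2, mul_one]
  simp only [h1]
  have h2 : ∑ b, (∑ a, P a * V a b) * Real.log (∑ a, P a * V a b)
      = ∑ a, ∑ b, P a * V a b * Real.log (∑ a', P a' * V a' b) := by
    rw [Finset.sum_comm]
    exact Finset.sum_congr rfl fun b _ => by rw [Finset.sum_mul]
  have h3 : ∑ a, P a * Real.log (P a) = ∑ a, ∑ b, P a * V a b * Real.log (P a) := by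
    refine Finset.sum_congr rfl fun a _ => ?_
    rw [← Finset.sum_mul, h1]
  rw [h2, h3, ← Finset.sum_neg_distrib, ← Finset.sum_neg_distrib, ← Finset.sum_neg_distrib,
    ← Finset.sum_add_distrib, ← Finset.sum_sub_distrib]
  refine Finset.sum_congr rfl fun a _ => ?_
  rw [← Finset.sum_neg_distrib, ← Finset.sum_neg_distrib, ← Finset.sum_neg_distrib,
    ← Finset.sum_add_distrib, ← Finset.sum_sub_distrib]
  refine Finset.sum_congr rfl fun b _ => ?_
  by_cases hp : P a = 0
  · simp [hp]
  by_cases hv : V a b = 0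
  · simp [hv]
  rw [Real.log_mul hp hv]; ring


/-- Exponential tilting function for the random coding bound. -/
def psiF {A B : Type} [Fintype A] [Fintype B] (P : A → ℝ) (V : A → B → ℝ) (s : ℝ) : ℝ :=
  ∑ a, ∑ b, P a * V a b *
    Real.exp (-s * (Real.log (V a b) - Real.log (∑ a', P a' * V a' b)))

lemma min_le_rpow (u v s : ℝ) (hu : 0 ≤ u) (hv : 0 ≤ v) (hs0 : 0 < s) (hs1 : s < 1) :
    min u v ≤ u ^ (1 - s) * v ^ s := by
  have h0 : 0 ≤ min u v := le_min hu hv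
  calc min u v = (min u v) ^ (1 - s) * (min u v) ^ s := by
        rw [← Real.rpow_add' h0 (by simp)]; simp
    _ ≤ _ := by
        gcongr
        · exact min_le_left _ _
        · exact min_le_right _ _

lemma tilt_eq {A B : Type} [Fintype A] [Fintype B] (P : A → ℝ) (hP : IsPMF P) (V : A → B → ℝ)
    (hV : IsChannel V) (s : ℝ) (hs1 : s < 1) (a : A) (b : B) :
    P a * ((V a b) ^ (1 - s) * (∑ a', P a' * V a' b) ^ s)
      = P a * V a b * Real.exp (-s * (Real.log (V a b) - Real.log (∑ a', P a' * V a' b))) := by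
  rcases (hP.1 a).eq_or_lt with hp | hp
  · simp [← hp]
  rcases ((hV a).1 b).eq_or_lt with hv | hv
  · rw [← hv, Real.zero_rpow (by linarith)]; simp
  have hq : 0 < ∑ a', P a' * V a' b :=
    lt_of_lt_of_le (mul_pos hp hv) (Finset.single_le_sum (f := fun a' => P a' * V a' b)
      (fun i _ => mul_nonneg (hP.1 i) ((hV i).1 b)) (Finset.mem_univ a))
  generalize (∑ a', P a' * V a' b) = z at hq ⊢
  rw [Real.rpow_def_of_pos hv, Real.rpow_def_of_pos hq, mul_assoc]
  congr 1
  conv_rhs => rw [← Real.exp_log hv]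
  rw [Real.log_exp, ← Real.exp_add, ← Real.exp_add]
  congr 1; ring

lemma nfold_bound {A B : Type} [Fintype A] [Fintype B] (P : A → ℝ) (hP : IsPMF P) (V : A → B → ℝ)
    (hV : IsChannel V) (s : ℝ) (hs0 : 0 < s) (hs1 : s < 1) (n M : ℕ) :
    ∑ x : Fin n → A, ∑ y : Fin n → B, (∏ t, P (x t)) *
      min (∏ t, V (x t) (y t)) (M * ∑ x' : Fin n → A, (∏ t, P (x' t)) * ∏ t, V (x' t) (y t))
      ≤ (M : ℝ) ^ s * (psiF P V s) ^ n := by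
  have hQ : ∀ y : Fin n → B, ∑ x' : Fin n → A, (∏ t, P (x' t)) * ∏ t, V (x' t) (y t)
      = ∏ t, ∑ a, P a * V a (y t) := by
    intro y
    rw [← sum_prod_pi (fun t a => P a * V a (y t))]
    exact Finset.sum_congr rfl fun x _ => by rw [Finset.prod_mul_distrib]
  simp_rw [hQ]
  have hq0 : ∀ b, 0 ≤ ∑ a, P a * V a b := fun b =>
    Finset.sum_nonneg fun a _ => mul_nonneg (hP.1 a) ((hV a).1 b)
  have hterm : ∀ (x : Fin n → A) (y : Fin n → B), (∏ t, P (x t)) *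
      min (∏ t, V (x t) (y t)) (M * ∏ t, ∑ a, P a * V a (y t))
      ≤ (M:ℝ) ^ s * ∏ t, (P (x t) * V (x t) (y t) *
        Real.exp (-s * (Real.log (V (x t) (y t)) - Real.log (∑ a', P a' * V a' (y t))))) := by
    intro x y
    have h1 : 0 ≤ ∏ t, V (x t) (y t) := Finset.prod_nonneg fun t _ => (hV _).1 _
    have h2 : 0 ≤ ∏ t, ∑ a, P a * V a (y t) := Finset.prod_nonneg fun t _ => hq0 _
    calc _ ≤ (∏ t, P (x t)) * ((∏ t, V (x t) (y t)) ^ (1 - s) *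
          (M * ∏ t, ∑ a, P a * V a (y t)) ^ s) := by
          refine mul_le_mul_of_nonneg_left (min_le_rpow _ _ s h1 (by positivity) hs0 hs1)
            (Finset.prod_nonneg fun t _ => hP.1 _)
      _ = (M:ℝ) ^ s * ∏ t, (P (x t) * ((V (x t) (y t)) ^ (1 - s) *
            (∑ a', P a' * V a' (y t)) ^ s)) := by
          rw [Real.mul_rpow (by positivity) h2, ← Real.finsetProd_rpow _ _ (fun t _ => (hV _).1 _),
            ← Real.finsetProd_rpow _ _ (fun t _ => hq0 _), Finset.prod_mul_distrib,
            Finset.prod_mul_distrib]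
          ring
      _ = _ := by
          congr 1
          exact Finset.prod_congr rfl fun t _ => tilt_eq P hP V hV s hs1 _ _
  refine (Finset.sum_le_sum fun x _ => Finset.sum_le_sum fun y _ => hterm x y).trans (le_of_eq ?_)
  simp_rw [← Finset.mul_sum]
  congr 1
  have h3 : ∀ x : Fin n → A, ∑ y : Fin n → B, ∏ t, (P (x t) * V (x t) (y t) *
        Real.exp (-s * (Real.log (V (x t) (y t)) - Real.log (∑ a', P a' * V a' (y t)))))
      = ∏ t, ∑ b, (P (x t) * V (x t) b *
        Real.exp (-s * (Real.log (V (x t) b) - Real.log (∑ a', P a' * V a' b)))) := by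
    intro x
    exact sum_prod_pi (fun t b => (P (x t) * V (x t) b *
        Real.exp (-s * (Real.log (V (x t) b) - Real.log (∑ a', P a' * V a' b)))))
  simp_rw [h3]
  rw [sum_prod_pi (fun (_ : Fin n) a => ∑ b, (P a * V a b *
        Real.exp (-s * (Real.log (V a b) - Real.log (∑ a', P a' * V a' b)))))]
  simp [psiF]

lemma exists_tilt {A B : Type} [Fintype A] [Fintype B] (P : A → ℝ) (hP : IsPMF P) (V : A → B → ℝ)
    (hV : IsChannel V) (R : ℝ) (hR : R < MI (fun a : A × B => P a.1 * V a.1 a.2)) :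
    ∃ s : ℝ, 0 < s ∧ s < 1 ∧ Real.exp (s * (R * Real.log 2)) * psiF P V s < 1 := by
  have hpsi0 : psiF P V 0 = 1 := by
    unfold psiF
    simp only [neg_zero, zero_mul, Real.exp_zero, mul_one]
    rw [← hP.2]
    refine Finset.sum_congr rfl fun a _ => ?_
    rw [← Finset.mul_sum, (hV a).2, mul_one]
  have hd1 : HasDerivAt (psiF P V) (-(MI (fun a : A × B => P a.1 * V a.1 a.2) * Real.log 2)) 0 := by
    rw [MI_eq P V hV]
    unfold psiF
    have : -(∑ a, ∑ b, P a * V a b * (Real.log (V a b) - Real.log (∑ a', P a' * V a' b)))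
      = ∑ a, ∑ b, P a * V a b * (Real.exp (-0 * (Real.log (V a b) - Real.log (∑ a', P a' * V a' b)))
        * (-1 * (Real.log (V a b) - Real.log (∑ a', P a' * V a' b)))) := by
      simp only [neg_zero, zero_mul, Real.exp_zero, ← Finset.sum_neg_distrib]
      exact Finset.sum_congr rfl fun a _ => Finset.sum_congr rfl fun b _ => by ring
    rw [this]
    refine HasDerivAt.fun_sum fun a _ => HasDerivAt.fun_sum fun b _ => ?_
    exact (((hasDerivAt_neg (0:ℝ)).mul_const _).exp).const_mul _
  have hd2 : HasDerivAt (fun s : ℝ => Real.exp (s * (R * Real.log 2))) (R * Real.log 2) 0 := by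
    have := ((hasDerivAt_id (0:ℝ)).mul_const (R * Real.log 2)).exp
    simpa using this
  have hd := hd2.mul hd1
  have hl := Real.log_pos one_lt_two
  have hneg : R * Real.log 2 * psiF P V 0 + Real.exp (0 * (R * Real.log 2)) *
      -(MI (fun a : A × B => P a.1 * V a.1 a.2) * Real.log 2) < 0 := by
    rw [hpsi0]; simp only [zero_mul, Real.exp_zero]
    nlinarith
  have ht := hasDerivAt_iff_tendsto_slope.1 hd
  have hev := ht.eventually (gt_mem_nhds hneg)
  have hev2 : ∀ᶠ s in nhdsWithin (0:ℝ) (Set.Ioi 0), slope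
      ((fun s : ℝ => Real.exp (s * (R * Real.log 2))) * psiF P V) 0 s < 0 :=
    hev.filter_mono (nhdsWithin_mono _ (fun x (hx : (0:ℝ) < x) => by
      simpa using hx.ne'))
  have hev3 : ∀ᶠ s in nhdsWithin (0:ℝ) (Set.Ioi 0), s ∈ Set.Ioo (0:ℝ) 1 :=
    Ioo_mem_nhdsGT one_pos
  obtain ⟨s, hs, hs1⟩ := (hev2.and hev3).exists
  refine ⟨s, hs1.1, hs1.2, ?_⟩
  rw [slope_def_field] at hs
  have h4 := (div_neg_iff.1 hs)
  simp only [Pi.mul_apply, hpsi0, zero_mul, Real.exp_zero, mul_one, sub_zero] at h4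
  rcases h4 with h4 | h4
  · linarith [hs1.1]
  · linarith

lemma coding {A B : Type} [Fintype A] [Fintype B] (V : A → B → ℝ)
    (hV : IsChannel V) (R : ℝ) (hR0 : 0 ≤ R) (hR : R < Cmarg V) (ε : ℝ) (hε : 0 < ε) :
    ∃ N : ℕ, ∀ n ≥ N, ∃ M : ℕ, 0 < M ∧ n * R ≤ Real.logb 2 M ∧
      ∃ (c : Fin M → Fin n → A) (g : (Fin n → B) → Fin M),
      (1 / (M:ℝ)) * ∑ m, ∑ y : Fin n → B, (∏ t, V (c m t) (y t)) * (if g y = m then 0 else 1) ≤ ε := by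
  have hne : {r | ∃ pX : A → ℝ, IsPMF pX ∧
      r = MI (fun a : A × B => pX a.1 * V a.1 a.2)}.Nonempty := by
    by_contra h
    rw [Set.not_nonempty_iff_eq_empty] at h
    unfold Cmarg at hR
    rw [h, Real.sSup_empty] at hR
    linarith
  obtain ⟨r, ⟨P, hP, rfl⟩, hRr⟩ := exists_lt_of_lt_csSup hne hR
  obtain ⟨s, hs0, hs1, hs⟩ := exists_tilt P hP V hV R hRr
  set z := Real.exp (s * (R * Real.log 2)) * psiF P V s with hz
  have hpsi : 0 ≤ psiF P V s := Finset.sum_nonneg fun a _ => Finset.sum_nonneg fun b _ =>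
    mul_nonneg (mul_nonneg (hP.1 a) ((hV a).1 b)) (Real.exp_pos _).le
  have hz0 : 0 ≤ z := mul_nonneg (Real.exp_pos _).le hpsi
  obtain ⟨N, hN⟩ := exists_pow_lt_of_lt_one (show 0 < ε / 2 by linarith) hs
  refine ⟨N, fun n hn => ?_⟩
  have hexp : (1:ℝ) ≤ (2:ℝ) ^ (n * R) := Real.one_le_rpow one_le_two (by positivity)
  set M := ⌈(2:ℝ) ^ (n * R)⌉₊ with hM
  have hMl : (2:ℝ) ^ (n * R) ≤ M := Nat.le_ceil _
  have hMu : (M:ℝ) ≤ 2 * (2:ℝ) ^ (n * R) := by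
    have := Nat.ceil_lt_add_one (show (0:ℝ) ≤ (2:ℝ) ^ (n * R) by linarith)
    linarith
  have hM0 : 0 < M := by
    have : (0:ℝ) < M := by linarith
    exact_mod_cast this
  refine ⟨M, hM0, ?_, ?_⟩
  · rw [Real.le_logb_iff_rpow_le one_lt_two (by exact_mod_cast hM0)]
    exact hMl
  obtain ⟨c, g, hcg⟩ := oneshot (fun x : Fin n → A => ∏ t, P (x t))
    ⟨fun x => Finset.prod_nonneg fun t _ => hP.1 _, by
      rw [sum_prod_pi (fun _ a => P a)]; simp [hP.2]⟩
    (fun x (y : Fin n → B) => ∏ t, V (x t) (y t))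
    (fun x => ⟨fun y => Finset.prod_nonneg fun t _ => (hV _).1 _, by
      rw [sum_prod_pi (fun t b => V (x t) b)]; simp [(hV _).2]⟩) M hM0
  refine ⟨c, g, hcg.trans ((nfold_bound P hP V hV s hs0 hs1 n M).trans ?_)⟩
  have h1 : (M:ℝ) ^ s ≤ 2 * (Real.exp (s * (R * Real.log 2))) ^ n := by
    calc (M:ℝ) ^ s ≤ (2 * (2:ℝ) ^ (n * R)) ^ s := by gcongr
      _ = (2:ℝ) ^ s * ((2:ℝ) ^ (n * R)) ^ s := Real.mul_rpow (by norm_num) (by linarith)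
      _ ≤ (2:ℝ) ^ (1:ℝ) * ((2:ℝ) ^ (n * R)) ^ s := by
          gcongr
          exact one_le_two
      _ = _ := by
          rw [Real.rpow_one, ← Real.exp_nat_mul, ← Real.rpow_mul (by norm_num),
            Real.rpow_def_of_pos (by norm_num)]
          congr 2; ring
  calc (M:ℝ) ^ s * psiF P V s ^ n ≤ 2 * (Real.exp (s * (R * Real.log 2))) ^ n * psiF P V s ^ n := by
        gcongr
    _ = 2 * z ^ n := by rw [hz, mul_pow]; ring
    _ ≤ 2 * z ^ N := by
        have := pow_le_pow_of_le_one hz0 hs.le hn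
        linarith
    _ ≤ ε := by linarith


section Marg
variable {X Y1 Y2 : Type} [Fintype Y1] [Fintype Y2]

lemma margW1_channel (W : X → Y1 × Y2 → ℝ) (hW : IsChannel W) : IsChannel (margW1 W) := fun x =>
  ⟨fun y => Finset.sum_nonneg fun _ _ => (hW x).1 _, by
    rw [← (hW x).2, Fintype.sum_prod_type]; rfl⟩

lemma margW2_channel (W : X → Y1 × Y2 → ℝ) (hW : IsChannel W) : IsChannel (margW2 W) := fun x =>
  ⟨fun y => Finset.sum_nonneg fun _ _ => (hW x).1 _, by
    rw [← (hW x).2, Fintype.sum_prod_type_right]; rfl⟩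

lemma marg_sum1 (W : X → Y1 × Y2 → ℝ) (n : ℕ) (x : Fin n → X) (F : (Fin n → Y1) → ℝ) :
    ∑ y : (Fin n → Y1) × (Fin n → Y2), nFold W n x y * F y.1
      = ∑ y1 : Fin n → Y1, (∏ t, margW1 W (x t) (y1 t)) * F y1 := by
  rw [Fintype.sum_prod_type]
  refine Finset.sum_congr rfl fun y1 _ => ?_
  dsimp only [nFold, margW1]
  rw [← Finset.sum_mul, sum_prod_pi (fun t y2 => W (x t) (y1 t, y2))]

lemma marg_sum2 (W : X → Y1 × Y2 → ℝ) (n : ℕ) (x : Fin n → X) (F : (Fin n → Y2) → ℝ) :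
    ∑ y : (Fin n → Y1) × (Fin n → Y2), nFold W n x y * F y.2
      = ∑ y2 : Fin n → Y2, (∏ t, margW2 W (x t) (y2 t)) * F y2 := by
  rw [Fintype.sum_prod_type_right]
  refine Finset.sum_congr rfl fun y2 _ => ?_
  dsimp only [nFold, margW2]
  rw [← Finset.sum_mul, sum_prod_pi (fun t y1 => W (x t) (y1, y2 t))]

lemma nFold_nonneg (W : X → Y1 × Y2 → ℝ) (hW : IsChannel W) (n : ℕ) (x : Fin n → X)
    (y : (Fin n → Y1) × (Fin n → Y2)) : 0 ≤ nFold W n x y :=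
  Finset.prod_nonneg fun _ _ => (hW _).1 _

end Marg

lemma sum_append_left {A B : Type} [Fintype B] (V : A → B → ℝ) (hV : IsChannel V) (n1 n2 : ℕ)
    (x1 : Fin n1 → A) (x2 : Fin n2 → A) (F : (Fin n1 → B) → ℝ) :
    ∑ y : Fin (n1 + n2) → B, (∏ t, V (Fin.append x1 x2 t) (y t)) *
        F (fun t => y (Fin.castAdd n2 t))
      = ∑ y : Fin n1 → B, (∏ t, V (x1 t) (y t)) * F y := by
  rw [← (Fin.appendEquiv n1 n2).sum_comp, Fintype.sum_prod_type]
  refine Finset.sum_congr rfl fun y1 _ => ?_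
  simp only [Fin.appendEquiv, Equiv.coe_fn_mk, Fin.prod_univ_add, Fin.append_left, Fin.append_right]
  rw [← Finset.sum_mul, ← Finset.mul_sum, sum_prod_pi (fun t b => V (x2 t) b)]
  simp [(hV _).2]

lemma sum_append_right {A B : Type} [Fintype B] (V : A → B → ℝ) (hV : IsChannel V) (n1 n2 : ℕ)
    (x1 : Fin n1 → A) (x2 : Fin n2 → A) (F : (Fin n2 → B) → ℝ) :
    ∑ y : Fin (n1 + n2) → B, (∏ t, V (Fin.append x1 x2 t) (y t)) *
        F (fun t => y (Fin.natAdd n1 t))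
      = ∑ y : Fin n2 → B, (∏ t, V (x2 t) (y t)) * F y := by
  rw [← (Fin.appendEquiv n1 n2).sum_comp, Fintype.sum_prod_type_right]
  refine Finset.sum_congr rfl fun y1 _ => ?_
  simp only [Fin.appendEquiv, Equiv.coe_fn_mk, Fin.prod_univ_add, Fin.append_left, Fin.append_right]
  rw [← Finset.sum_mul, ← Finset.sum_mul, sum_prod_pi (fun t b => V (x1 t) b)]
  simp [(hV _).2]

section TS
variable {X Y1 Y2 : Type} [Fintype Y1] [Fintype Y2]

lemma avg_split (k1 k2 : ℕ) (hk1 : 0 < k1) (hk2 : 0 < k2) (E1 : Fin k1 → ℝ) (E2 : Fin k2 → ℝ) :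
    1 / ((k1:ℝ) * (k2:ℝ)) * ∑ m : Fin k1 × Fin k2, (E1 m.1 + E2 m.2)
      = 1 / (k1:ℝ) * ∑ m, E1 m + 1 / (k2:ℝ) * ∑ m, E2 m := by
  have hk1' : (0:ℝ) < k1 := by exact_mod_cast hk1
  have hk2' : (0:ℝ) < k2 := by exact_mod_cast hk2
  rw [Finset.sum_add_distrib, Fintype.sum_prod_type, Fintype.sum_prod_type]
  simp only [Finset.sum_const, Finset.card_univ, Fintype.card_fin, nsmul_eq_mul]
  rw [← Finset.mul_sum]
  field_simp

lemma timeshare_err (W : X → Y1 × Y2 → ℝ) (hW : IsChannel W) (n1 n2 k1 k2 : ℕ)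
    (hk1 : 0 < k1) (hk2 : 0 < k2)
    (c1 : Fin k1 → Fin n1 → X) (c2 : Fin k2 → Fin n2 → X)
    (g1 : (Fin n1 → Y1) → Fin k1) (g2 : (Fin n2 → Y2) → Fin k2) :
    errP0 W (n1 + n2) k1 k2 (fun m => Fin.append (c1 m.1) (c2 m.2))
      (fun y => g1 (fun t => y (Fin.castAdd n2 t))) (fun y => g2 (fun t => y (Fin.natAdd n1 t)))
    ≤ (1 / (k1:ℝ)) * ∑ m, ∑ y : Fin n1 → Y1,
        (∏ t, margW1 W (c1 m t) (y t)) * (if g1 y = m then 0 else 1)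
      + (1 / (k2:ℝ)) * ∑ m, ∑ y : Fin n2 → Y2,
        (∏ t, margW2 W (c2 m t) (y t)) * (if g2 y = m then 0 else 1) := by
  have hk1' : (0:ℝ) < k1 := by exact_mod_cast hk1
  have hk2' : (0:ℝ) < k2 := by exact_mod_cast hk2
  unfold errP0
  have hm : ∀ m : Fin k1 × Fin k2, ∑ y : (Fin (n1+n2) → Y1) × (Fin (n1+n2) → Y2),
      nFold W (n1+n2) (Fin.append (c1 m.1) (c2 m.2)) y *
        (if g1 (fun t => y.1 (Fin.castAdd n2 t)) = m.1 ∧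
          g2 (fun t => y.2 (Fin.natAdd n1 t)) = m.2 then 0 else 1)
      ≤ ∑ y : Fin n1 → Y1, (∏ t, margW1 W (c1 m.1 t) (y t)) * (if g1 y = m.1 then 0 else 1)
        + ∑ y : Fin n2 → Y2, (∏ t, margW2 W (c2 m.2 t) (y t)) * (if g2 y = m.2 then 0 else 1) := by
    intro m
    rw [← sum_append_left (margW1 W) (margW1_channel W hW) n1 n2 (c1 m.1) (c2 m.2)
        (fun y => if g1 y = m.1 then 0 else 1),
      ← sum_append_right (margW2 W) (margW2_channel W hW) n1 n2 (c1 m.1) (c2 m.2)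
        (fun y => if g2 y = m.2 then 0 else 1),
      ← marg_sum1 W (n1+n2) _
        (fun y => if g1 (fun t => y (Fin.castAdd n2 t)) = m.1 then 0 else 1),
      ← marg_sum2 W (n1+n2) _
        (fun y => if g2 (fun t => y (Fin.natAdd n1 t)) = m.2 then 0 else 1),
      ← Finset.sum_add_distrib]
    refine Finset.sum_le_sum fun y _ => ?_
    rw [← mul_add]
    refine mul_le_mul_of_nonneg_left ?_ (nFold_nonneg W hW _ _ _)
    by_cases h1 : g1 (fun t => y.1 (Fin.castAdd n2 t)) = m.1 <;>
    by_cases h2 : g2 (fun t => y.2 (Fin.natAdd n1 t)) = m.2 <;> simp [h1, h2]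
  refine (mul_le_mul_of_nonneg_left (Finset.sum_le_sum fun m _ => hm m) (by positivity)).trans
    (le_of_eq ?_)
  exact avg_split k1 k2 hk1 hk2 (fun m => ∑ y : Fin n1 → Y1,
      (∏ t, margW1 W (c1 m t) (y t)) * (if g1 y = m then 0 else 1))
    (fun m => ∑ y : Fin n2 → Y2, (∏ t, margW2 W (c2 m t) (y t)) * (if g2 y = m then 0 else 1))

lemma ach0_triangle [Fintype X] (W : X → Y1 × Y2 → ℝ) (hW : IsChannel W)
    (hC1 : 0 < Cmarg (margW1 W)) (hC2 : 0 < Cmarg (margW2 W)) (R : ℝ × ℝ)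
    (h1 : 0 ≤ R.1) (h2 : 0 ≤ R.2)
    (h : R.1 / Cmarg (margW1 W) + R.2 / Cmarg (margW2 W) < 1) : Ach0 W R := by
  refine ⟨h1, h2, fun ε hε => ?_⟩
  set C1 := Cmarg (margW1 W) with hc1
  set C2 := Cmarg (margW2 W) with hc2
  set σ := (1 - (R.1 / C1 + R.2 / C2)) / 2 with hσ
  have hσ0 : 0 < σ := by rw [hσ]; linarith
  set l1 := R.1 / C1 + σ with hl1
  set l2 := R.2 / C2 + σ with hl2
  have hr1 : 0 ≤ R.1 / C1 := by positivity
  have hr2 : 0 ≤ R.2 / C2 := by positivity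
  have hl10 : 0 < l1 := by positivity
  have hl20 : 0 < l2 := by positivity
  have hl : l1 + l2 = 1 := by rw [hl1, hl2, hσ]; ring
  have hRl1 : R.1 / l1 < C1 := by
    rw [div_lt_iff₀ hl10, hl1, mul_add, mul_div_cancel₀ _ hC1.ne']
    nlinarith
  have hRl2 : R.2 / l2 < C2 := by
    rw [div_lt_iff₀ hl20, hl2, mul_add, mul_div_cancel₀ _ hC2.ne']
    nlinarith
  obtain ⟨S1, hS1, hS1'⟩ := exists_between hRl1
  have hS10 : 0 ≤ S1 := (by positivity : 0 ≤ R.1 / l1).trans hS1.le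
  obtain ⟨N1, hN1⟩ := coding (margW1 W) (margW1_channel W hW) S1 hS10 hS1' (ε/2) (by linarith)
  obtain ⟨N2, hN2⟩ := coding (margW2 W) (margW2_channel W hW) (R.2 / l2) (by positivity) hRl2
    (ε/2) (by linarith)
  have hgap : 0 < l1 * S1 - R.1 := by
    rw [div_lt_iff₀ hl10] at hS1; linarith
  obtain ⟨n, hn⟩ := exists_nat_ge (max (max ((N1 + 1) / l1) (N2 / l2)) (max 1 (S1 / (l1 * S1 - R.1))))
  have hnA : (N1 + 1) / l1 ≤ n := (le_max_left _ _).trans ((le_max_left _ _).trans hn)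
  have hnB : N2 / l2 ≤ n := (le_max_right _ _).trans ((le_max_left _ _).trans hn)
  have hnC : 1 ≤ (n:ℝ) := (le_max_left _ _).trans ((le_max_right _ _).trans hn)
  have hnD : S1 / (l1 * S1 - R.1) ≤ n := (le_max_right _ _).trans ((le_max_right _ _).trans hn)
  rw [div_le_iff₀ hl10] at hnA
  rw [div_le_iff₀ hl20] at hnB
  rw [div_le_iff₀ hgap] at hnD
  set n1 := ⌊l1 * n⌋₊ with hn1
  have hfl : (n1:ℝ) ≤ l1 * n := Nat.floor_le (by positivity)
  have hfu : l1 * n < n1 + 1 := Nat.lt_floor_add_one _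
  have hn1n : n1 ≤ n := by
    have : (n1:ℝ) ≤ n := by nlinarith
    exact_mod_cast this
  obtain ⟨n2, hn2⟩ := Nat.exists_eq_add_of_le hn1n
  have hn2' : (n2:ℝ) = n - n1 := by rw [hn2]; push_cast; ring
  have hn2l : l2 * n ≤ n2 := by
    rw [hn2']
    have : l2 * n = n - l1 * n := by rw [← sub_eq_of_eq_add' hl.symm]; ring
    linarith
  obtain ⟨k1, hk1, hlog1, c1, g1, he1⟩ := hN1 n1 (by
    have : (N1:ℝ) ≤ n1 := by nlinarith
    exact_mod_cast this)
  obtain ⟨k2, hk2, hlog2, c2, g2, he2⟩ := hN2 n2 (by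
    have : (N2:ℝ) ≤ n2 := by nlinarith
    exact_mod_cast this)
  have hn0 : (0:ℝ) < n := by linarith
  have hnn : ((n1 + n2 : ℕ) : ℝ) = n := by rw [← hn2]
  refine ⟨n1 + n2, k1, k2, ?_, hk1, hk2, _, _, _, ?_, ?_,
    (timeshare_err W hW n1 n2 k1 k2 hk1 hk2 c1 c2 g1 g2).trans (by linarith)⟩
  · rw [← hn2]; exact_mod_cast hn0
  · rw [hnn, le_div_iff₀ hn0]
    refine le_trans ?_ hlog1
    nlinarith
  · rw [hnn, le_div_iff₀ hn0]
    refine le_trans ?_ hlog2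
    calc R.2 * n = (l2 * n) * (R.2 / l2) := by field_simp
      _ ≤ n2 * (R.2 / l2) := mul_le_mul_of_nonneg_right hn2l (div_nonneg h2 hl20.le)

lemma ach1_of_ach0 (W : X → Y1 × Y2 → ℝ) (R : ℝ × ℝ) (h : Ach0 W R) : Ach1 W R := by
  refine ⟨h.1, h.2.1, fun ε hε => ?_⟩
  obtain ⟨n, k1, k2, hn, hk1, hk2, f, g1, g2, hR1, hR2, he⟩ := h.2.2 ε hε
  exact ⟨n, k1, k2, hn, hk1, hk2, f, fun y => g1 y.1, g2, hR1, hR2, he⟩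

lemma ach2_of_ach0 (W : X → Y1 × Y2 → ℝ) (R : ℝ × ℝ) (h : Ach0 W R) : Ach2 W R := by
  refine ⟨h.1, h.2.1, fun ε hε => ?_⟩
  obtain ⟨n, k1, k2, hn, hk1, hk2, f, g1, g2, hR1, hR2, he⟩ := h.2.2 ε hε
  exact ⟨n, k1, k2, hn, hk1, hk2, f, g1, fun y => g2 y.1, hR1, hR2, he⟩

lemma cap_triangle [Fintype X] (W : X → Y1 × Y2 → ℝ) (hW : IsChannel W)
    (hC1 : 0 < Cmarg (margW1 W)) (hC2 : 0 < Cmarg (margW2 W)) (R : ℝ × ℝ)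
    (h1 : 0 ≤ R.1) (h2 : 0 ≤ R.2)
    (h : R.1 / Cmarg (margW1 W) + R.2 / Cmarg (margW2 W) ≤ 1) : R ∈ Cap W := by
  have ht : Filter.Tendsto (fun n : ℕ => ((1 - 1 / ((n:ℝ) + 1)) * R.1, (1 - 1 / ((n:ℝ) + 1)) * R.2))
      Filter.atTop (nhds R) := by
    have h0 : Filter.Tendsto (fun n : ℕ => (1 - 1 / ((n:ℝ) + 1))) Filter.atTop (nhds 1) := by
      simpa using tendsto_const_nhds.sub (tendsto_one_div_add_atTop_nhds_zero_nat (𝕜 := ℝ))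
    have := (h0.mul_const R.1).prodMk_nhds (h0.mul_const R.2)
    simpa using this
  refine mem_closure_of_tendsto ht (Filter.Eventually.of_forall fun n => ?_)
  have hp : (0:ℝ) < 1 / ((n:ℝ) + 1) := by positivity
  have hp1 : 1 / ((n:ℝ) + 1) ≤ 1 := by
    rw [div_le_one (by positivity)]; linarith [(Nat.cast_nonneg n : (0:ℝ) ≤ n)]
  refine ach0_triangle W hW hC1 hC2 _ (mul_nonneg (by linarith) h1) (mul_nonneg (by linarith) h2) ?_
  have hs : 0 ≤ R.1 / Cmarg (margW1 W) + R.2 / Cmarg (margW2 W) := by positivity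
  calc _ = (1 - 1 / ((n:ℝ) + 1)) * (R.1 / Cmarg (margW1 W) + R.2 / Cmarg (margW2 W)) := by
        simp only; ring
    _ ≤ (1 - 1 / ((n:ℝ) + 1)) * 1 := mul_le_mul_of_nonneg_left h (by linarith)
    _ < 1 := by linarith

end TS


lemma MI_le_Cmarg {A B : Type} [Fintype A] [Fintype B] (V : A → B → ℝ) (hC : 0 < Cmarg V)
    (P : A → ℝ) (hP : IsPMF P) : MI (fun a : A × B => P a.1 * V a.1 a.2) ≤ Cmarg V := by
  unfold Cmarg at hC ⊢
  refine le_csSup ?_ ⟨P, hP, rfl⟩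
  by_contra hb
  rw [Real.sSup_of_not_bddAbove hb] at hC
  exact lt_irrefl _ hC

/-- The empirical mutual information bound for a map from messages to letters. -/
lemma emp_MI {A B M : Type} [Fintype A] [Fintype B] [Fintype M] [Nonempty M] (V : A → B → ℝ)
    (hV : IsChannel V) (hC : 0 < Cmarg V) (x : M → A) :
    (1 / (Fintype.card M : ℝ)) * ∑ m, ∑ b, V (x m) b * (Real.log (V (x m) b) -
      Real.log ((1 / (Fintype.card M : ℝ)) * ∑ m', V (x m') b)) ≤ Cmarg V * Real.log 2 := by
  have hc : (0:ℝ) < Fintype.card M := by exact_mod_cast Fintype.card_pos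
  set μ := 1 / (Fintype.card M : ℝ) with hμ
  let P : A → ℝ := fun a => μ * ∑ m, if x m = a then 1 else 0
  have hF : ∀ F : A → ℝ, ∑ a, P a * F a = μ * ∑ m, F (x m) := by
    intro F
    simp only [P, mul_assoc, ← Finset.mul_sum, Finset.sum_mul]
    rw [Finset.sum_comm]
    simp
  have hP : IsPMF P := by
    refine ⟨fun a => ?_, ?_⟩
    · exact mul_nonneg (by positivity) (Finset.sum_nonneg fun _ _ => by split_ifs <;> norm_num)
    · have := hF (fun _ => 1)
      simp only [mul_one] at this
      rw [this]; simp [hμ]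
  have h1 := MI_eq P V hV
  have h2 := MI_le_Cmarg V hC P hP
  have h3 : MI (fun a : A × B => P a.1 * V a.1 a.2) * Real.log 2 ≤ Cmarg V * Real.log 2 :=
    mul_le_mul_of_nonneg_right h2 (Real.log_pos one_lt_two).le
  refine le_trans (le_of_eq ?_) h3
  rw [h1]
  have h4 : ∀ b, ∑ a', P a' * V a' b = μ * ∑ m', V (x m') b := fun b => hF (fun a => V a b)
  simp only [h4]
  have := hF (fun a => ∑ b, V a b * (Real.log (V a b) - Real.log (μ * ∑ m', V (x m') b)))
  rw [← this]
  refine Finset.sum_congr rfl fun a _ => ?_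
  rw [Finset.mul_sum]
  exact Finset.sum_congr rfl fun b _ => by ring

lemma pointwise_kl (p q L T : ℝ) (hp : 0 ≤ p) (hq : 0 ≤ q)
    (h : 0 < p → 0 < q ∧ L = Real.log p - Real.log q) :
    p * T + p - q * Real.exp T ≤ p * L := by
  rcases hp.eq_or_lt with h0 | h0
  · rw [← h0]; have := mul_nonneg hq (Real.exp_pos T).le; linarith
  obtain ⟨hq0, hL⟩ := h h0
  have h1 : Real.log (q * Real.exp T / p) ≤ q * Real.exp T / p - 1 :=
    Real.log_le_sub_one_of_pos (by positivity)
  rw [Real.log_div (by positivity) h0.ne', Real.log_mul hq0.ne' (Real.exp_pos T).ne',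
    Real.log_exp] at h1
  have h2 : p * (q * Real.exp T / p) = q * Real.exp T := by field_simp
  rw [hL]
  nlinarith

lemma converse_core {A B M : Type} [Fintype A] [Fintype B] [Fintype M] [Nonempty M] (V : A → B → ℝ)
    (hV : IsChannel V) (hC : 0 < Cmarg V) (n : ℕ) (x : M → Fin n → A)
    (S : M → (Fin n → B) → Prop) [∀ m y, Decidable (S m y)] (k : ℕ) (hk : 0 < k)
    (hS : ∀ Q : (Fin n → B) → ℝ, ∑ y, Q y = 1 →
      (1 / (Fintype.card M : ℝ)) * ∑ m, ∑ y, Q y * (if S m y then 1 else 0) = 1 / (k:ℝ))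
    (ε : ℝ) (hε0 : 0 < ε) (hε1 : ε < 1)
    (he : (1 / (Fintype.card M : ℝ)) * ∑ m, ∑ y, (∏ t, V (x m t) (y t)) * (if S m y then 0 else 1)
      ≤ ε) :
    (1 - ε) * Real.log k + Real.log (1 - ε) + ε * Real.log ε ≤ n * (Cmarg V * Real.log 2) := by
  have hc : (0:ℝ) < Fintype.card M := by exact_mod_cast Fintype.card_pos
  have hk' : (1:ℝ) ≤ k := by exact_mod_cast hk
  set μ := 1 / (Fintype.card M : ℝ) with hμ
  have hμ0 : 0 < μ := by positivity
  have hμ1 : μ * Fintype.card M = 1 := by rw [hμ]; field_simp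
  have hV0 : ∀ a b, 0 ≤ V a b := fun a b => (hV a).1 b
  set p : M → (Fin n → B) → ℝ := fun m y => ∏ t, V (x m t) (y t) with hp
  set q : Fin n → B → ℝ := fun t b => μ * ∑ m', V (x m' t) b with hq
  set Q : (Fin n → B) → ℝ := fun y => ∏ t, q t (y t) with hQ
  have hq0 : ∀ t b, 0 ≤ q t b := fun t b =>
    mul_nonneg hμ0.le (Finset.sum_nonneg fun _ _ => hV0 _ _)
  have hp0 : ∀ m y, 0 ≤ p m y := fun m y => Finset.prod_nonneg fun _ _ => hV0 _ _
  have hQ0 : ∀ y, 0 ≤ Q y := fun y => Finset.prod_nonneg fun _ _ => hq0 _ _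
  have hq1 : ∀ t, ∑ b, q t b = 1 := by
    intro t
    simp only [hq]
    rw [← Finset.mul_sum, Finset.sum_comm]
    simp only [(hV _).2]
    simpa using hμ1
  have hp1 : ∀ m, ∑ y, p m y = 1 := by
    intro m
    simp only [hp]
    rw [sum_prod_pi (fun t b => V (x m t) b)]
    simp [(hV _).2]
  have hQ1 : ∑ y, Q y = 1 := by
    simp only [hQ]
    rw [sum_prod_pi q]; simp [hq1]
  set L : M → (Fin n → B) → ℝ := fun m y =>
    ∑ t, (Real.log (V (x m t) (y t)) - Real.log (q t (y t))) with hL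
  -- upper bound
  have hup : μ * ∑ m, ∑ y, p m y * L m y ≤ n * (Cmarg V * Real.log 2) := by
    have h1 : ∀ m, ∑ y, p m y * L m y
        = ∑ t, ∑ b, V (x m t) b * (Real.log (V (x m t) b) - Real.log (q t b)) := by
      intro m
      simp only [hL, Finset.mul_sum]
      rw [Finset.sum_comm]
      refine Finset.sum_congr rfl fun t _ => ?_
      exact sum_prod_one (fun t b => V (x m t) b) (fun t => (hV _).2) t
        (fun b => Real.log (V (x m t) b) - Real.log (q t b))
    simp only [h1]
    rw [Finset.sum_comm, Finset.mul_sum]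
    calc _ ≤ ∑ t : Fin n, Cmarg V * Real.log 2 :=
          Finset.sum_le_sum fun t _ => emp_MI V hV hC (fun m => x m t)
      _ = _ := by simp
  set τ1 := Real.log k + Real.log (1 - ε) with hτ1
  set τ0 := Real.log ε with hτ0
  have he1 : Real.exp τ1 = k * (1 - ε) := by
    rw [hτ1, Real.exp_add, Real.exp_log (by linarith), Real.exp_log (by linarith)]
  have he0 : Real.exp τ0 = ε := Real.exp_log hε0
  have hpt : ∀ m y, p m y * (τ1 + 1) - (τ1 - τ0) * (p m y * (if S m y then 0 else 1))
      - (k * (1 - ε) * (Q y * (if S m y then 1 else 0)) + ε * Q y) ≤ p m y * L m y := by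
    intro m y
    have hcond : 0 < p m y → 0 < Q y ∧ L m y = Real.log (p m y) - Real.log (Q y) := by
      intro hpos
      have hne : ∀ t, V (x m t) (y t) ≠ 0 := fun t => by
        have := Finset.prod_ne_zero_iff.1 hpos.ne'
        exact this t (Finset.mem_univ t)
      have hqp : ∀ t, 0 < q t (y t) := fun t => by
        refine mul_pos hμ0 (lt_of_lt_of_le (lt_of_le_of_ne (hV0 _ _) (hne t).symm)
          (Finset.single_le_sum (f := fun m' => V (x m' t) (y t))
            (fun _ _ => hV0 _ _) (Finset.mem_univ m)))
      refine ⟨Finset.prod_pos fun t _ => hqp t, ?_⟩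
      simp only [hL, hp, hQ]
      rw [Real.log_prod (fun t _ => hne t), Real.log_prod (fun t _ => (hqp t).ne'),
        Finset.sum_sub_distrib]
    by_cases hs : S m y
    · have := pointwise_kl (p m y) (Q y) (L m y) τ1 (hp0 m y) (hQ0 y) hcond
      rw [he1] at this
      rw [if_pos hs, if_pos hs]
      have := mul_nonneg hε0.le (hQ0 y)
      linarith
    · have := pointwise_kl (p m y) (Q y) (L m y) τ0 (hp0 m y) (hQ0 y) hcond
      rw [he0] at this
      rw [if_neg hs, if_neg hs]
      linarith
  have hsum : μ * ∑ m, ∑ y, (p m y * (τ1 + 1) - (τ1 - τ0) * (p m y * (if S m y then 0 else 1))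
      - (k * (1 - ε) * (Q y * (if S m y then 1 else 0)) + ε * Q y)) ≤ μ * ∑ m, ∑ y, p m y * L m y := by
    refine mul_le_mul_of_nonneg_left ?_ hμ0.le
    exact Finset.sum_le_sum fun m _ => Finset.sum_le_sum fun y _ => hpt m y
  set e := μ * ∑ m, ∑ y, p m y * (if S m y then 0 else 1) with hedef
  have he0' : 0 ≤ e := mul_nonneg hμ0.le (Finset.sum_nonneg fun m _ => Finset.sum_nonneg fun y _ =>
    mul_nonneg (hp0 m y) (by split_ifs <;> norm_num))
  have hleft : μ * ∑ m, ∑ y, (p m y * (τ1 + 1) - (τ1 - τ0) * (p m y * (if S m y then 0 else 1))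
      - (k * (1 - ε) * (Q y * (if S m y then 1 else 0)) + ε * Q y))
      = (τ1 + 1) - (τ1 - τ0) * e - ((1 - ε) + ε) := by
    simp only [Finset.sum_sub_distrib, Finset.sum_add_distrib, ← Finset.mul_sum, ← Finset.sum_mul,
      hp1, hQ1]
    rw [mul_sub, mul_sub]
    have h1 : μ * ((τ1 - τ0) * ∑ m, ∑ y, p m y * (if S m y then 0 else 1)) = (τ1 - τ0) * e := by
      rw [hedef]; ring
    have h2 : μ * (k * (1 - ε) * ∑ m, ∑ y, Q y * (if S m y then 1 else 0)) = 1 - ε := by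
      have := hS Q hQ1
      calc _ = k * (1 - ε) * (μ * ∑ m, ∑ y, Q y * (if S m y then 1 else 0)) := by ring
        _ = _ := by rw [this]; field_simp
    rw [h1]
    simp only [Finset.sum_const, Finset.card_univ, nsmul_eq_mul, mul_one, one_mul]
    linear_combination (τ1 + 1 - ε) * hμ1 - h2
  rw [hleft] at hsum
  have hlk : 0 ≤ Real.log k := Real.log_nonneg hk'
  have hl1 : Real.log (1 - ε) ≤ 0 := Real.log_nonpos (by linarith) (by linarith)
  have hl0 : Real.log ε ≤ 0 := Real.log_nonpos hε0.le hε1.le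
  have a1 : (1 - ε) * Real.log k ≤ (1 - e) * Real.log k :=
    mul_le_mul_of_nonneg_right (by linarith) hlk
  have a2 : 0 ≤ e * (- Real.log (1 - ε)) := mul_nonneg he0' (by linarith)
  have a3 : 0 ≤ (ε - e) * (- Real.log ε) := mul_nonneg (by linarith) (by linarith)
  rw [hτ1, hτ0] at hsum
  nlinarith

/-- The limiting argument of the weak converse. -/
lemma converse_limit (R C : ℝ) (hR : 0 ≤ R)
    (h : ∀ ε : ℝ, 0 < ε → ε < 1 → ∃ n k : ℕ, 0 < n ∧ 0 < k ∧ R ≤ Real.logb 2 k / n ∧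
      (1 - ε) * Real.log k + Real.log (1 - ε) + ε * Real.log ε ≤ n * (C * Real.log 2)) :
    R ≤ C := by
  have hl := Real.log_pos one_lt_two
  have h1 : ∀ ε : ℝ, 0 < ε → ε < 1 →
      (1 - ε) * (R * Real.log 2) + Real.log (1 - ε) + ε * Real.log ε ≤ C * Real.log 2 := by
    intro ε h0 h1
    obtain ⟨n, k, hn, hk, hR', hh⟩ := h ε h0 h1
    have hn' : (1:ℝ) ≤ n := by exact_mod_cast hn
    rw [le_div_iff₀ (by linarith), Real.logb, le_div_iff₀ hl] at hR'
    have hl1 : Real.log (1 - ε) ≤ 0 := Real.log_nonpos (by linarith) (by linarith)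
    have hl0 : Real.log ε ≤ 0 := Real.log_nonpos h0.le h1.le
    have hneg : Real.log (1 - ε) + ε * Real.log ε ≤ 0 := by nlinarith
    have h2 : (1 - ε) * (R * n * Real.log 2) ≤ (1 - ε) * Real.log k :=
      mul_le_mul_of_nonneg_left hR' (by linarith)
    have h3 : n * (Real.log (1 - ε) + ε * Real.log ε) ≤ Real.log (1 - ε) + ε * Real.log ε := by
      nlinarith
    have h4 : n * ((1 - ε) * (R * Real.log 2) + Real.log (1 - ε) + ε * Real.log ε)
        ≤ n * (C * Real.log 2) := by nlinarith
    exact le_of_mul_le_mul_left h4 (by linarith)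
  have hcont : ContinuousAt (fun ε : ℝ =>
      (1 - ε) * (R * Real.log 2) + Real.log (1 - ε) + ε * Real.log ε) 0 := by
    refine ContinuousAt.add (ContinuousAt.add (by fun_prop) ?_) Real.continuous_mul_log.continuousAt
    exact ContinuousAt.log (by fun_prop) (by norm_num)
  have ht : Filter.Tendsto (fun ε : ℝ =>
      (1 - ε) * (R * Real.log 2) + Real.log (1 - ε) + ε * Real.log ε)
      (nhdsWithin 0 (Set.Ioi 0)) (nhds (R * Real.log 2)) := by
    have := hcont.tendsto.mono_left (nhdsWithin_le_nhds (s := Set.Ioi 0))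
    simpa using this
  have hev : ∀ᶠ ε in nhdsWithin (0:ℝ) (Set.Ioi 0),
      (1 - ε) * (R * Real.log 2) + Real.log (1 - ε) + ε * Real.log ε ≤ C * Real.log 2 := by
    filter_upwards [Ioo_mem_nhdsGT (one_pos : (0:ℝ) < 1)] with ε hε
    exact h1 ε hε.1 hε.2
  exact le_of_mul_le_mul_right (le_of_tendsto ht hev) hl

section Conv
variable {X Y1 Y2 : Type} [Fintype X] [Fintype Y1] [Fintype Y2]

lemma ach1_le (W : X → Y1 × Y2 → ℝ) (hW : IsChannel W)
    (hC1 : 0 < Cmarg (margW1 W)) (hC2 : 0 < Cmarg (margW2 W)) (R : ℝ × ℝ) (h : Ach1 W R) :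
    R.1 ≤ Cmarg (margW1 W) ∧ R.2 ≤ Cmarg (margW2 W) := by
  constructor
  · refine converse_limit _ _ h.1 fun ε hε0 hε1 => ?_
    obtain ⟨n, k1, k2, hn, hk1, hk2, f, g1, g2, hR1, hR2, he⟩ := h.2.2 ε hε0
    haveI : Nonempty (Fin k1 × Fin k2) := ⟨(⟨0, hk1⟩, ⟨0, hk2⟩)⟩
    have hk1' : (0:ℝ) < k1 := by exact_mod_cast hk1
    have hk2' : (0:ℝ) < k2 := by exact_mod_cast hk2
    have hcard : (Fintype.card (Fin k1 × Fin k2) : ℝ) = k1 * k2 := by simp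
    refine ⟨n, k1, hn, hk1, hR1, converse_core (margW1 W) (margW1_channel W hW) hC1 n f
      (fun m y => g1 (y, m.2) = m.1) k1 hk1 ?_ ε hε0 hε1 (le_trans ?_ he)⟩
    · intro Q hQ
      rw [hcard, Fintype.sum_prod_type_right]
      have : ∀ b : Fin k2, ∑ a : Fin k1, ∑ y, Q y * (if g1 (y, b) = a then (1:ℝ) else 0) = 1 := by
        intro b
        rw [Finset.sum_comm]
        simp [hQ]
      simp only [this]
      simp; field_simp
    · rw [hcard]
      unfold errP1
      refine mul_le_mul_of_nonneg_left (Finset.sum_le_sum fun m _ => ?_) (by positivity)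
      beta_reduce
      rw [← marg_sum1 W n (f m) (fun y => if g1 (y, m.2) = m.1 then 0 else 1)]
      refine Finset.sum_le_sum fun y _ => mul_le_mul_of_nonneg_left ?_ (nFold_nonneg W hW _ _ _)
      by_cases h1 : g1 (y.1, m.2) = m.1 <;> by_cases h2 : g2 y.2 = m.2 <;> simp [h1, h2]
  · refine converse_limit _ _ h.2.1 fun ε hε0 hε1 => ?_
    obtain ⟨n, k1, k2, hn, hk1, hk2, f, g1, g2, hR1, hR2, he⟩ := h.2.2 ε hε0
    haveI : Nonempty (Fin k1 × Fin k2) := ⟨(⟨0, hk1⟩, ⟨0, hk2⟩)⟩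
    have hk1' : (0:ℝ) < k1 := by exact_mod_cast hk1
    have hk2' : (0:ℝ) < k2 := by exact_mod_cast hk2
    have hcard : (Fintype.card (Fin k1 × Fin k2) : ℝ) = k1 * k2 := by simp
    refine ⟨n, k2, hn, hk2, hR2, converse_core (margW2 W) (margW2_channel W hW) hC2 n f
      (fun m y => g2 y = m.2) k2 hk2 ?_ ε hε0 hε1 (le_trans ?_ he)⟩
    · intro Q hQ
      rw [hcard, Fintype.sum_prod_type]
      have : ∑ a : Fin k2, ∑ y, Q y * (if g2 y = a then (1:ℝ) else 0) = 1 := by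
        rw [Finset.sum_comm]
        simp [hQ]
      simp only [this]
      simp; field_simp
    · rw [hcard]
      unfold errP1
      refine mul_le_mul_of_nonneg_left (Finset.sum_le_sum fun m _ => ?_) (by positivity)
      beta_reduce
      rw [← marg_sum2 W n (f m) (fun y => if g2 y = m.2 then 0 else 1)]
      refine Finset.sum_le_sum fun y _ => mul_le_mul_of_nonneg_left ?_ (nFold_nonneg W hW _ _ _)
      by_cases h1 : g1 (y.1, m.2) = m.1 <;> by_cases h2 : g2 y.2 = m.2 <;> simp [h1, h2]

lemma ach2_le (W : X → Y1 × Y2 → ℝ) (hW : IsChannel W)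
    (hC1 : 0 < Cmarg (margW1 W)) (hC2 : 0 < Cmarg (margW2 W)) (R : ℝ × ℝ) (h : Ach2 W R) :
    R.1 ≤ Cmarg (margW1 W) ∧ R.2 ≤ Cmarg (margW2 W) := by
  constructor
  · refine converse_limit _ _ h.1 fun ε hε0 hε1 => ?_
    obtain ⟨n, k1, k2, hn, hk1, hk2, f, g1, g2, hR1, hR2, he⟩ := h.2.2 ε hε0
    haveI : Nonempty (Fin k1 × Fin k2) := ⟨(⟨0, hk1⟩, ⟨0, hk2⟩)⟩
    have hk1' : (0:ℝ) < k1 := by exact_mod_cast hk1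
    have hk2' : (0:ℝ) < k2 := by exact_mod_cast hk2
    have hcard : (Fintype.card (Fin k1 × Fin k2) : ℝ) = k1 * k2 := by simp
    refine ⟨n, k1, hn, hk1, hR1, converse_core (margW1 W) (margW1_channel W hW) hC1 n f
      (fun m y => g1 y = m.1) k1 hk1 ?_ ε hε0 hε1 (le_trans ?_ he)⟩
    · intro Q hQ
      rw [hcard, Fintype.sum_prod_type_right]
      have : ∑ a : Fin k1, ∑ y, Q y * (if g1 y = a then (1:ℝ) else 0) = 1 := by
        rw [Finset.sum_comm]
        simp [hQ]
      simp only [this]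
      simp; field_simp
    · rw [hcard]
      unfold errP2
      refine mul_le_mul_of_nonneg_left (Finset.sum_le_sum fun m _ => ?_) (by positivity)
      beta_reduce
      rw [← marg_sum1 W n (f m) (fun y => if g1 y = m.1 then 0 else 1)]
      refine Finset.sum_le_sum fun y _ => mul_le_mul_of_nonneg_left ?_ (nFold_nonneg W hW _ _ _)
      by_cases h1 : g1 y.1 = m.1 <;> by_cases h2 : g2 (y.2, m.1) = m.2 <;> simp [h1, h2]
  · refine converse_limit _ _ h.2.1 fun ε hε0 hε1 => ?_
    obtain ⟨n, k1, k2, hn, hk1, hk2, f, g1, g2, hR1, hR2, he⟩ := h.2.2 ε hε0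
    haveI : Nonempty (Fin k1 × Fin k2) := ⟨(⟨0, hk1⟩, ⟨0, hk2⟩)⟩
    have hk1' : (0:ℝ) < k1 := by exact_mod_cast hk1
    have hk2' : (0:ℝ) < k2 := by exact_mod_cast hk2
    have hcard : (Fintype.card (Fin k1 × Fin k2) : ℝ) = k1 * k2 := by simp
    refine ⟨n, k2, hn, hk2, hR2, converse_core (margW2 W) (margW2_channel W hW) hC2 n f
      (fun m y => g2 (y, m.1) = m.2) k2 hk2 ?_ ε hε0 hε1 (le_trans ?_ he)⟩
    · intro Q hQ
      rw [hcard, Fintype.sum_prod_type]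
      have : ∀ b : Fin k1, ∑ a : Fin k2, ∑ y, Q y * (if g2 (y, b) = a then (1:ℝ) else 0) = 1 := by
        intro b
        rw [Finset.sum_comm]
        simp [hQ]
      simp only [this]
      simp; field_simp
    · rw [hcard]
      unfold errP2
      refine mul_le_mul_of_nonneg_left (Finset.sum_le_sum fun m _ => ?_) (by positivity)
      beta_reduce
      rw [← marg_sum2 W n (f m) (fun y => if g2 (y, m.1) = m.2 then 0 else 1)]
      refine Finset.sum_le_sum fun y _ => mul_le_mul_of_nonneg_left ?_ (nFold_nonneg W hW _ _ _)
      by_cases h1 : g1 y.1 = m.1 <;> by_cases h2 : g2 (y.2, m.1) = m.2 <;> simp [h1, h2]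

lemma cap1_le (W : X → Y1 × Y2 → ℝ) (hW : IsChannel W)
    (hC1 : 0 < Cmarg (margW1 W)) (hC2 : 0 < Cmarg (margW2 W)) (R : ℝ × ℝ) (h : R ∈ Cap1 W) :
    R.1 ≤ Cmarg (margW1 W) ∧ R.2 ≤ Cmarg (margW2 W) :=
  closure_minimal (t := {R : ℝ × ℝ | R.1 ≤ Cmarg (margW1 W) ∧ R.2 ≤ Cmarg (margW2 W)})
    (fun R hR => ach1_le W hW hC1 hC2 R hR)
    ((isClosed_le continuous_fst continuous_const).inter
      (isClosed_le continuous_snd continuous_const)) h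

lemma cap2_le (W : X → Y1 × Y2 → ℝ) (hW : IsChannel W)
    (hC1 : 0 < Cmarg (margW1 W)) (hC2 : 0 < Cmarg (margW2 W)) (R : ℝ × ℝ) (h : R ∈ Cap2 W) :
    R.1 ≤ Cmarg (margW1 W) ∧ R.2 ≤ Cmarg (margW2 W) :=
  closure_minimal (t := {R : ℝ × ℝ | R.1 ≤ Cmarg (margW1 W) ∧ R.2 ≤ Cmarg (margW2 W)})
    (fun R hR => ach2_le W hW hC1 hC2 R hR)
    ((isClosed_le continuous_fst continuous_const).inter
      (isClosed_le continuous_snd continuous_const)) h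

end Conv


/-- Twice the inverse hyperbolic tangent. -/
def Ath (x : ℝ) : ℝ := Real.log (1 + x) - Real.log (1 - x)

/-- The capacity (in nats) of a binary symmetric channel with correlation `x`. -/
def Gf (x : ℝ) : ℝ := Real.log 2 - Real.binEntropy ((1 - x) / 2)

lemma Ath_zero : Ath 0 = 0 := by simp [Ath]

lemma Gf_zero : Gf 0 = 0 := by
  have : ((1:ℝ) - 0) / 2 = 2⁻¹ := by norm_num
  rw [Gf, this, Real.binEntropy_two_inv, sub_self]

lemma Gf_cont : Continuous Gf := by
  unfold Gf
  exact continuous_const.sub (Real.binEntropy_continuous.comp (by fun_prop))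

lemma Ath_nonneg (x : ℝ) (h0 : 0 ≤ x) (h1 : x < 1) : 0 ≤ Ath x := by
  unfold Ath
  have := Real.log_le_log (by linarith : 0 < 1 - x) (by linarith : 1 - x ≤ 1 + x)
  linarith

lemma Ath_pos (x : ℝ) (h0 : 0 < x) (h1 : x < 1) : 0 < Ath x := by
  unfold Ath
  have := Real.log_lt_log (by linarith : 0 < 1 - x) (by linarith : 1 - x < 1 + x)
  linarith

lemma Ath_mono (x y : ℝ) (h0 : 0 ≤ x) (h : x ≤ y) (h1 : y < 1) : Ath x ≤ Ath y := by
  unfold Ath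
  have a := Real.log_le_log (by linarith : 0 < 1 - y) (by linarith : 1 - y ≤ 1 - x)
  have b := Real.log_le_log (by linarith : 0 < 1 + x) (by linarith : 1 + x ≤ 1 + y)
  linarith

lemma Ath_deriv (a t : ℝ) (h0 : -1 < t * a) (h1 : t * a < 1) :
    HasDerivAt (fun s => Ath (s * a)) (2 * a / (1 - (t * a) ^ 2)) t := by
  have hb : HasDerivAt (fun s : ℝ => s * a) (1 * a) t := (hasDerivAt_id t).mul_const a
  have hp : HasDerivAt (fun s : ℝ => Real.log (1 + s * a)) (1 * a / (1 + t * a)) t :=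
    (hb.const_add 1).log (by linarith)
  have hm : HasDerivAt (fun s : ℝ => Real.log (1 - s * a)) (-(1 * a) / (1 - t * a)) t :=
    (hb.const_sub 1).log (by linarith)
  refine (hp.sub hm).congr_deriv ?_
  have e1 : 1 + t * a ≠ 0 := by linarith
  have e2 : 1 - t * a ≠ 0 := by linarith
  have e3 : 1 - (t * a) ^ 2 ≠ 0 := by
    have : 1 - (t * a) ^ 2 = (1 + t * a) * (1 - t * a) := by ring
    rw [this]; exact mul_ne_zero e1 e2
  rw [div_sub_div _ _ e1 e2, div_eq_div_iff (mul_ne_zero e1 e2) e3]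
  ring

lemma Gf_deriv (a t : ℝ) (h0 : -1 < t * a) (h1 : t * a < 1) :
    HasDerivAt (fun s => Gf (s * a)) (a / 2 * Ath (t * a)) t := by
  have hb : HasDerivAt (fun s : ℝ => (1 - s * a) / 2) (-(1 * a) / 2) t :=
    (((hasDerivAt_id t).mul_const a).const_sub 1).div_const 2
  have h := Real.hasDerivAt_binEntropy (p := (1 - t * a) / 2) (by linarith) (by linarith)
  refine ((h.comp t hb).const_sub (Real.log 2)).congr_deriv ?_
  have e : 1 - (1 - t * a) / 2 = (1 + t * a) / 2 := by ring
  rw [e, Real.log_div (by linarith) two_ne_zero, Real.log_div (by linarith) two_ne_zero, Ath]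
  ring

lemma mono_aux (f f' : ℝ → ℝ) (hc : ContinuousOn f (Set.Icc 0 1))
    (hd : ∀ t ∈ Set.Ioo (0:ℝ) 1, HasDerivAt f (f' t) t) (hf : ∀ t ∈ Set.Ioo (0:ℝ) 1, 0 ≤ f' t) :
    MonotoneOn f (Set.Icc 0 1) := by
  refine monotoneOn_of_deriv_nonneg (convex_Icc 0 1) hc ?_ ?_
  · rw [interior_Icc]
    exact fun t ht => (hd t ht).differentiableAt.differentiableWithinAt
  · rw [interior_Icc]
    exact fun t ht => by rw [(hd t ht).deriv]; exact hf t ht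

lemma mul_mem_aux {a t : ℝ} (ha0 : 0 ≤ a) (ha1 : a < 1) (ht0 : 0 ≤ t) (ht1 : t ≤ 1) :
    0 ≤ t * a ∧ t * a < 1 :=
  ⟨mul_nonneg ht0 ha0, lt_of_le_of_lt (mul_le_of_le_one_left ha0 ht1) ha1⟩

/-- `Ath x / x` is nondecreasing. -/
lemma Ath_star (a b : ℝ) (hb : 0 ≤ b) (hba : b ≤ a) (ha : a < 1) : a * Ath b ≤ b * Ath a := by
  have ha0 := hb.trans hba
  have hb1 := hba.trans_lt ha
  have hd : ∀ t ∈ Set.Icc (0:ℝ) 1, HasDerivAt (fun s => b * Ath (s * a) - a * Ath (s * b))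
      (b * (2 * a / (1 - (t * a) ^ 2)) - a * (2 * b / (1 - (t * b) ^ 2))) t := by
    intro t ht
    have h1 := mul_mem_aux ha0 ha ht.1 ht.2
    have h2 := mul_mem_aux hb hb1 ht.1 ht.2
    exact ((Ath_deriv a t (by linarith) h1.2).const_mul b).sub
      ((Ath_deriv b t (by linarith) h2.2).const_mul a)
  have hm := mono_aux _ _ (fun t ht => (hd t ht).continuousAt.continuousWithinAt)
    (fun t ht => hd t ⟨ht.1.le, ht.2.le⟩) (by
      intro t ht
      have h1 := mul_mem_aux ha0 ha ht.1.le ht.2.le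
      have h2 := mul_mem_aux hb hb1 ht.1.le ht.2.le
      have h3 : t * b ≤ t * a := mul_le_mul_of_nonneg_left hba ht.1.le
      have h4 : 0 < 1 - (t * a) ^ 2 := by nlinarith
      have h5 : 1 - (t * a) ^ 2 ≤ 1 - (t * b) ^ 2 := by nlinarith
      have h6 : 2 * a * b / (1 - (t * b) ^ 2) ≤ 2 * a * b / (1 - (t * a) ^ 2) :=
        div_le_div_of_nonneg_left (by positivity) h4 h5
      have e1 : b * (2 * a / (1 - (t * a) ^ 2)) = 2 * a * b / (1 - (t * a) ^ 2) := by ring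
      have e2 : a * (2 * b / (1 - (t * b) ^ 2)) = 2 * a * b / (1 - (t * b) ^ 2) := by ring
      rw [e1, e2]; linarith)
  have := hm ⟨le_rfl, zero_le_one⟩ ⟨zero_le_one, le_rfl⟩ zero_le_one
  simp only [zero_mul, Ath_zero, mul_zero, sub_zero, one_mul] at this
  linarith

lemma Ath_psi (a b : ℝ) (hb : 0 ≤ b) (hba : b ≤ a) (ha : a < 1) :
    b * (Ath a * (1 - a ^ 2)) ≤ a * (Ath b * (1 - b ^ 2)) := by
  have ha0 := hb.trans hba
  have hb1 := hba.trans_lt ha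
  have hq : ∀ c t : ℝ, HasDerivAt (fun s : ℝ => 1 - (s * c) ^ 2) (-(2 * t * c ^ 2)) t := by
    intro c t
    have := ((((hasDerivAt_id t).mul_const c).pow 2).const_sub 1)
    refine this.congr_deriv ?_
    simp; ring
  have hone : ∀ c t : ℝ, 0 ≤ t * c → t * c < 1 →
      HasDerivAt (fun s : ℝ => Ath (s * c) * (1 - (s * c) ^ 2))
        (2 * c - Ath (t * c) * (2 * t * c ^ 2)) t := by
    intro c t h0 h1
    refine ((Ath_deriv c t (by linarith) h1).mul (hq c t)).congr_deriv ?_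
    have : 1 - (t * c) ^ 2 ≠ 0 := by nlinarith
    rw [div_mul_cancel₀ _ this]
    ring
  have hd : ∀ t ∈ Set.Icc (0:ℝ) 1, HasDerivAt
      (fun s => a * (Ath (s * b) * (1 - (s * b) ^ 2)) - b * (Ath (s * a) * (1 - (s * a) ^ 2)))
      (a * (2 * b - Ath (t * b) * (2 * t * b ^ 2)) - b * (2 * a - Ath (t * a) * (2 * t * a ^ 2)))
      t := by
    intro t ht
    have h1 := mul_mem_aux ha0 ha ht.1 ht.2
    have h2 := mul_mem_aux hb hb1 ht.1 ht.2
    exact ((hone b t h2.1 h2.2).const_mul a).sub ((hone a t h1.1 h1.2).const_mul b)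
  have hm := mono_aux _ _ (fun t ht => (hd t ht).continuousAt.continuousWithinAt)
    (fun t ht => hd t ⟨ht.1.le, ht.2.le⟩) (by
      intro t ht
      have h1 := mul_mem_aux ha0 ha ht.1.le ht.2.le
      have h2 := mul_mem_aux hb hb1 ht.1.le ht.2.le
      have h3 : t * b ≤ t * a := mul_le_mul_of_nonneg_left hba ht.1.le
      have h4 := Ath_mono _ _ h2.1 h3 h1.2
      have h5 := Ath_nonneg _ h2.1 h2.2
      have h6 : b * Ath (t * b) ≤ a * Ath (t * a) := mul_le_mul hba h4 h5 ha0
      have e : a * (2 * b - Ath (t * b) * (2 * t * b ^ 2)) -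
          b * (2 * a - Ath (t * a) * (2 * t * a ^ 2))
          = 2 * t * a * b * (a * Ath (t * a) - b * Ath (t * b)) := by ring
      rw [e]
      have := ht.1
      exact mul_nonneg (by positivity) (by linarith))
  have := hm ⟨le_rfl, zero_le_one⟩ ⟨zero_le_one, le_rfl⟩ zero_le_one
  simp only [zero_mul, Ath_zero, mul_zero, sub_zero, one_mul] at this
  linarith

lemma Ath_ratio (a b t : ℝ) (hb : 0 < b) (hba : b ≤ a) (ha : a < 1) (ht0 : 0 < t) (ht1 : t ≤ 1) :
    Ath (t * a) * Ath b ≤ Ath a * Ath (t * b) := by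
  have ha0 := hb.trans_le hba
  have hb1 := hba.trans_lt ha
  have hd : ∀ s ∈ Set.Ioc (0:ℝ) 1, HasDerivAt (fun s => Ath (s * a) / Ath (s * b))
      ((2 * a / (1 - (s * a) ^ 2) * Ath (s * b) - Ath (s * a) * (2 * b / (1 - (s * b) ^ 2)))
        / Ath (s * b) ^ 2) s := by
    intro s hs
    have h1 := mul_mem_aux ha0.le ha hs.1.le hs.2
    have h2 := mul_mem_aux hb.le hb1 hs.1.le hs.2
    exact (Ath_deriv a s (by linarith) h1.2).div (Ath_deriv b s (by linarith) h2.2)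
      (Ath_pos _ (mul_pos hs.1 hb) h2.2).ne'
  have hm : MonotoneOn (fun s => Ath (s * a) / Ath (s * b)) (Set.Ioc 0 1) := by
    refine monotoneOn_of_deriv_nonneg (convex_Ioc 0 1)
      (fun s hs => (hd s hs).continuousAt.continuousWithinAt) ?_ ?_
    · rw [interior_Ioc]
      exact fun s hs => (hd s ⟨hs.1, hs.2.le⟩).differentiableAt.differentiableWithinAt
    · rw [interior_Ioc]
      intro s hs
      rw [(hd s ⟨hs.1, hs.2.le⟩).deriv]
      refine div_nonneg ?_ (sq_nonneg _)
      have h1 := mul_mem_aux ha0.le ha hs.1.le hs.2.le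
      have h2 := mul_mem_aux hb.le hb1 hs.1.le hs.2.le
      have h3 := Ath_psi (s * a) (s * b) h2.1 (mul_le_mul_of_nonneg_left hba hs.1.le) h1.2
      have h4 : 0 < 1 - (s * a) ^ 2 := by nlinarith
      have h5 : 0 < 1 - (s * b) ^ 2 := by nlinarith
      have h6 : b * (Ath (s * a) * (1 - (s * a) ^ 2)) ≤ a * (Ath (s * b) * (1 - (s * b) ^ 2)) := by
        refine le_of_mul_le_mul_left ?_ hs.1
        linarith
      rw [sub_nonneg]
      have e1 : Ath (s * a) * (2 * b / (1 - (s * b) ^ 2))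
          = 2 * (b * Ath (s * a)) / (1 - (s * b) ^ 2) := by ring
      have e2 : 2 * a / (1 - (s * a) ^ 2) * Ath (s * b)
          = 2 * (a * Ath (s * b)) / (1 - (s * a) ^ 2) := by ring
      rw [e1, e2, div_le_div_iff₀ h5 h4]
      linarith
  have h := hm ⟨ht0, ht1⟩ ⟨one_pos, le_rfl⟩ ht1
  simp only [one_mul] at h
  have h2 := mul_mem_aux hb.le hb1 ht0.le ht1
  rwa [div_le_div_iff₀ (Ath_pos _ (mul_pos ht0 hb) h2.2) (Ath_pos _ hb hb1)] at h

lemma Gf_key1 (a b c : ℝ) (hb : 0 < b) (hba : b ≤ a) (ha : a ≤ 1)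
    (hc : c ≤ a ^ 2 / b ^ 2) (β : ℝ) (h0 : 0 ≤ β) (h1 : β ≤ 1) :
    c * Gf (β * b) ≤ Gf (β * a) ∧ c * (Gf b - Gf (β * b)) ≤ Gf a - Gf (β * a) := by
  have ha0 := hb.trans_le hba
  have hlt : ∀ x : ℝ, 0 < x → x ≤ 1 → ∀ t ∈ Set.Ioo (0:ℝ) 1, 0 < t * x ∧ t * x < 1 :=
    fun x hx hx1 t ht => ⟨mul_pos ht.1 hx, by nlinarith [ht.1, ht.2]⟩
  have hm := mono_aux (fun s => Gf (s * a) - c * Gf (s * b))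
    (fun t => a / 2 * Ath (t * a) - c * (b / 2 * Ath (t * b)))
    (by
      refine Continuous.continuousOn ?_
      exact (Gf_cont.comp (by fun_prop)).sub (continuous_const.mul (Gf_cont.comp (by fun_prop))))
    (fun t ht => by
      have h1 := hlt a ha0 ha t ht
      have h2 := hlt b hb (hba.trans ha) t ht
      exact (Gf_deriv a t (by linarith) h1.2).sub ((Gf_deriv b t (by linarith) h2.2).const_mul c))
    (fun t ht => by
      have h1 := hlt a ha0 ha t ht
      have h2 := hlt b hb (hba.trans ha) t ht
      have h3 := Ath_star (t * a) (t * b) h2.1.le (mul_le_mul_of_nonneg_left hba ht.1.le) h1.2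
      have h4 : a * Ath (t * b) ≤ b * Ath (t * a) := by
        refine le_of_mul_le_mul_left ?_ ht.1
        linarith
      rw [le_div_iff₀ (by positivity)] at hc
      have h5 := Ath_nonneg _ h2.1.le h2.2
      have h6 := mul_le_mul_of_nonneg_right hc h5
      have h7 := mul_le_mul_of_nonneg_left h4 ha0.le
      have h8 : b * (c * (b * Ath (t * b))) ≤ b * (a * Ath (t * a)) := by nlinarith
      have h9 := le_of_mul_le_mul_left h8 hb
      linarith)
  have k1 := hm ⟨le_rfl, zero_le_one⟩ ⟨h0, h1⟩ h0
  have k2 := hm ⟨h0, h1⟩ ⟨zero_le_one, le_rfl⟩ h1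
  simp only [zero_mul, Gf_zero, mul_zero, sub_zero, one_mul] at k1 k2
  constructor <;> linarith

lemma Gf_key2 (a b c : ℝ) (hb : 0 < b) (hba : b ≤ a) (ha : a < 1)
    (hc : a * Ath a / (b * Ath b) ≤ c) (β : ℝ) (h0 : 0 ≤ β) (h1 : β ≤ 1) :
    Gf (β * a) ≤ c * Gf (β * b) ∧ Gf a - Gf (β * a) ≤ c * (Gf b - Gf (β * b)) := by
  have ha0 := hb.trans_le hba
  have hb1 := hba.trans_lt ha
  have hAb := Ath_pos b hb hb1
  have hm := mono_aux (fun s => c * Gf (s * b) - Gf (s * a))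
    (fun t => c * (b / 2 * Ath (t * b)) - a / 2 * Ath (t * a))
    (by
      refine Continuous.continuousOn ?_
      exact (continuous_const.mul (Gf_cont.comp (by fun_prop))).sub (Gf_cont.comp (by fun_prop)))
    (fun t ht => by
      have h1 := mul_mem_aux ha0.le ha ht.1.le ht.2.le
      have h2 := mul_mem_aux hb.le hb1 ht.1.le ht.2.le
      exact ((Gf_deriv b t (by linarith) h2.2).const_mul c).sub (Gf_deriv a t (by linarith) h1.2))
    (fun t ht => by
      have h1 := mul_mem_aux ha0.le ha ht.1.le ht.2.le
      have h2 := mul_mem_aux hb.le hb1 ht.1.le ht.2.le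
      have h3 := Ath_ratio a b t hb hba ha ht.1 ht.2.le
      rw [div_le_iff₀ (mul_pos hb hAb)] at hc
      have h5 := Ath_nonneg _ h2.1 h2.2
      have h6 := mul_le_mul_of_nonneg_right hc h5
      have h7 := mul_le_mul_of_nonneg_left h3 ha0.le
      have h8 : Ath b * (a * Ath (t * a)) ≤ Ath b * (c * (b * Ath (t * b))) := by nlinarith
      have h9 := le_of_mul_le_mul_left h8 hAb
      linarith)
  have k1 := hm ⟨le_rfl, zero_le_one⟩ ⟨h0, h1⟩ h0
  have k2 := hm ⟨h0, h1⟩ ⟨zero_le_one, le_rfl⟩ h1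
  simp only [zero_mul, Gf_zero, mul_zero, sub_zero, one_mul] at k1 k2
  constructor <;> linarith

lemma one_sub_Hb (d : ℝ) : 1 - Hb d = Gf (1 - 2 * d) / Real.log 2 := by
  have hl := Real.log_pos one_lt_two
  have e : (1 - (1 - 2 * d)) / 2 = d := by ring
  rw [Gf, e, Real.binEntropy_eq_negMulLog_add_negMulLog_one_sub, Hb, Real.logb, Real.logb,
    Real.negMulLog, Real.negMulLog]
  field_simp
  ring

lemma one_sub_Hb_conv (α d : ℝ) :
    1 - Hb (bconv α d) = Gf ((1 - 2 * α) * (1 - 2 * d)) / Real.log 2 := by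
  rw [one_sub_Hb]; congr 2; unfold bconv; ring

lemma Hb_lt_one (d : ℝ) (h1 : d < 1 / 2) : 0 < 1 - Hb d := by
  rw [one_sub_Hb]
  refine div_pos ?_ (Real.log_pos one_lt_two)
  have e : (1 - (1 - 2 * d)) / 2 = d := by ring
  rw [Gf, e, sub_pos, Real.binEntropy_lt_log_two]
  norm_num at h1 ⊢
  exact h1.ne

lemma ent1 (d e c : ℝ) (hd : 0 ≤ d) (hde : d ≤ e) (he : e < 1 / 2)
    (hc : c ≤ (1 - 2 * d) ^ 2 / (1 - 2 * e) ^ 2) (α : ℝ) (hα : α ∈ Set.Icc (0:ℝ) (1 / 2)) :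
    c * (1 - Hb (bconv α e)) ≤ 1 - Hb (bconv α d) ∧
      c * (Hb (bconv α e) - Hb e) ≤ Hb (bconv α d) - Hb d := by
  have hl := Real.log_pos one_lt_two
  obtain ⟨k1, k2⟩ := Gf_key1 (1 - 2 * d) (1 - 2 * e) c (by linarith) (by linarith) (by linarith) hc
    (1 - 2 * α) (by linarith [hα.2]) (by linarith [hα.1])
  have e1 := one_sub_Hb_conv α d
  have e2 := one_sub_Hb_conv α e
  have e3 := one_sub_Hb d
  have e4 := one_sub_Hb e
  rw [eq_div_iff hl.ne'] at e1 e2 e3 e4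
  rw [← e1, ← e2] at k1
  rw [← e1, ← e2, ← e3, ← e4] at k2
  constructor
  · refine le_of_mul_le_mul_right ?_ hl
    linarith
  · refine le_of_mul_le_mul_right ?_ hl
    nlinarith

lemma lrf_eq (d : ℝ) (h0 : 0 < d) (h1 : d < 1 / 2) :
    lrf d = (1 - 2 * d) * Ath (1 - 2 * d) / Real.log 2 := by
  have e1 : 1 + (1 - 2 * d) = 2 * (1 - d) := by ring
  have e2 : 1 - (1 - 2 * d) = 2 * d := by ring
  rw [lrf, Real.logb, Ath, e1, e2, Real.log_mul two_ne_zero (by linarith),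
    Real.log_mul two_ne_zero h0.ne', Real.log_div (by linarith) h0.ne']
  ring

lemma ent2 (d e c : ℝ) (hd : 0 ≤ d) (hde : d ≤ e) (he : e < 1 / 2)
    (hc : lrRatioLe d e c) (α : ℝ) (hα : α ∈ Set.Icc (0:ℝ) (1 / 2)) :
    1 - Hb (bconv α d) ≤ c * (1 - Hb (bconv α e)) ∧
      Hb (bconv α d) - Hb d ≤ c * (Hb (bconv α e) - Hb e) := by
  have hl := Real.log_pos one_lt_two
  unfold lrRatioLe at hc
  have hd0 : d = 0 ∨ 0 < d := hd.eq_or_lt.imp Eq.symm id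
  rcases hd0 with h | h
  · rw [if_pos h] at hc
    split_ifs at hc with h'
    subst h; subst h'
    -- the trivial comparison of a channel with itself
    have hself := ent1 0 0 0 le_rfl le_rfl (by norm_num) (by norm_num) α hα
    simp only [zero_mul] at hself
    constructor <;> nlinarith [hself.1, hself.2]
  · rw [if_neg h.ne'] at hc
    rw [lrf_eq d h (by linarith), lrf_eq e (by linarith) he, div_div_div_cancel_right₀ hl.ne'] at hc
    obtain ⟨k1, k2⟩ := Gf_key2 (1 - 2 * d) (1 - 2 * e) c (by linarith) (by linarith) (by linarith)
      hc (1 - 2 * α) (by linarith [hα.2]) (by linarith [hα.1])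
    have e1 := one_sub_Hb_conv α d
    have e2 := one_sub_Hb_conv α e
    have e3 := one_sub_Hb d
    have e4 := one_sub_Hb e
    rw [eq_div_iff hl.ne'] at e1 e2 e3 e4
    rw [← e1, ← e2] at k1
    rw [← e1, ← e2, ← e3, ← e4] at k2
    constructor
    · refine le_of_mul_le_mul_right ?_ hl
      linarith
    · refine le_of_mul_le_mul_right ?_ hl
      nlinarith

lemma bconv_zero (d : ℝ) : bconv 0 d = d := by unfold bconv; ring
lemma Hb_half : Hb (1 / 2) = 1 := by
  have := one_sub_Hb (1 / 2)
  norm_num [Gf_zero] at this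
  norm_num
  linarith
lemma bconv_half (d : ℝ) : bconv (1 / 2) d = 1 / 2 := by unfold bconv; ring

lemma least_aux (S : Set (ℝ × ℝ)) (C1 C2 d1 d2 κ : ℝ) (hC1 : 0 < C1) (hC2 : 0 < C2)
    (hd11 : d1 < 1 / 2) (hd21 : d2 < 1 / 2)
    (htri : ∀ R : ℝ × ℝ, 0 ≤ R.1 → 0 ≤ R.2 → R.1 / C1 + R.2 / C2 ≤ 1 → R ∈ S)
    (hbox : ∀ R ∈ S, R.1 ≤ C1 ∧ R.2 ≤ C2)
    (hκ : κ = (1 - Hb d1) / C1 ∨ κ = (1 - Hb d2) / C2)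
    (hα : ∀ α ∈ Set.Icc (0:ℝ) (1 / 2),
      (Hb (bconv α d1) - Hb d1) / C1 + (1 - Hb (bconv α d2)) / C2 ≤ κ) :
    IsLeast {κ : ℝ | 0 ≤ κ ∧ CBSBC d1 d2 ⊆ scaleSet κ S} κ ∧
      max ((1 - Hb d1) / C1) ((1 - Hb d2) / C2) = κ := by
  have g1 := Hb_lt_one d1 hd11
  have g2 := Hb_lt_one d2 hd21
  have b1 : (1 - Hb d1) / C1 ≤ κ := by
    have := hα (1 / 2) ⟨by norm_num, le_rfl⟩
    simpa only [bconv_half, Hb_half, sub_self, zero_div, add_zero] using this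
  have b2 : (1 - Hb d2) / C2 ≤ κ := by
    have := hα 0 ⟨le_rfl, by norm_num⟩
    simpa only [bconv_zero, sub_self, zero_div, zero_add] using this
  have hκ0 : 0 < κ := lt_of_lt_of_le (div_pos g1 hC1) b1
  refine ⟨⟨⟨hκ0.le, ?_⟩, ?_⟩, ?_⟩
  · rintro R ⟨h1, h2, α, hm, hR1, hR2⟩
    refine ⟨(R.1 / κ, R.2 / κ), htri _ (div_nonneg h1 hκ0.le) (div_nonneg h2 hκ0.le) ?_, ?_⟩
    · have a1 := div_le_div_of_nonneg_right hR1 hC1.le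
      have a2 := div_le_div_of_nonneg_right hR2 hC2.le
      have a3 := hα α hm
      have e : R.1 / κ / C1 + R.2 / κ / C2 = (R.1 / C1 + R.2 / C2) / κ := by field_simp
      rw [e, div_le_one hκ0]
      linarith
    · ext <;> simp <;> field_simp
  · rintro k ⟨hk0, hk⟩
    rcases hκ with h | h
    · have hmem : ((1 - Hb d1, 0) : ℝ × ℝ) ∈ CBSBC d1 d2 :=
        ⟨g1.le, le_rfl, 1 / 2, ⟨by norm_num, le_rfl⟩, by simp only [bconv_half, Hb_half]; exact le_rfl,
          by simp only [bconv_half, Hb_half]; norm_num⟩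
      obtain ⟨R, hR, he⟩ := hk hmem
      have he1 : k * R.1 = 1 - Hb d1 := congrArg Prod.fst he
      rw [h, div_le_iff₀ hC1, ← he1]
      exact mul_le_mul_of_nonneg_left (hbox R hR).1 hk0
    · have hmem : ((0, 1 - Hb d2) : ℝ × ℝ) ∈ CBSBC d1 d2 :=
        ⟨le_rfl, g2.le, 0, ⟨le_rfl, by norm_num⟩, by simp only [bconv_zero]; norm_num,
          by simp only [bconv_zero]; exact le_rfl⟩
      obtain ⟨R, hR, he⟩ := hk hmem
      have he1 : k * R.2 = 1 - Hb d2 := congrArg Prod.snd he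
      rw [h, div_le_iff₀ hC2, ← he1]
      exact mul_le_mul_of_nonneg_left (hbox R hR).2 hk0
  · refine le_antisymm (max_le b1 b2) ?_
    rcases hκ with h | h
    · rw [h]; exact le_max_left _ _
    · rw [h]; exact le_max_right _ _

lemma ratio_le_aux {C1 C2 u v : ℝ} (hC1 : 0 < C1) (hC2 : 0 < C2) (h : C1 / C2 * u ≤ v) :
    u / C2 ≤ v / C1 := by
  rw [le_div_iff₀ hC1]
  refine le_trans (le_of_eq ?_) h
  ring

lemma ratio_ge_aux {C1 C2 u v : ℝ} (hC1 : 0 < C1) (hC2 : 0 < C2) (h : v ≤ C1 / C2 * u) :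
    v / C1 ≤ u / C2 := by
  rw [div_le_iff₀ hC1]
  refine le_trans h (le_of_eq ?_)
  ring


/-- **Proposition 10.** Cases in which the optimal bandwidth-expansion bound `κ*`
coincides with the point-to-point separation bound `κ†`. -/
theorem kappaStar_eq_kappaDagger
    {X Y1 Y2 : Type} [Fintype X] [Fintype Y1] [Fintype Y2]
    [Nonempty X] [Nonempty Y1] [Nonempty Y2]
    (W : X → Y1 × Y2 → ℝ) (hW : IsChannel W)
    (hC1 : 0 < Cmarg (margW1 W)) (hC2 : 0 < Cmarg (margW2 W))
    (d1 d2 : ℝ) (hd10 : 0 ≤ d1) (hd11 : d1 < 1/2) (hd20 : 0 ≤ d2) (hd21 : d2 < 1/2) :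
    (d1 ≤ d2 →
      ((1 - 2*d1)^2 / (1 - 2*d2)^2 ≥ Cmarg (margW1 W) / Cmarg (margW2 W) →
        IsLeast {κ : ℝ | 0 ≤ κ ∧ CBSBC d1 d2 ⊆ scaleSet κ (Cap1 W)}
          ((1 - Hb d1) / Cmarg (margW1 W)) ∧
        max ((1 - Hb d1) / Cmarg (margW1 W)) ((1 - Hb d2) / Cmarg (margW2 W))
          = (1 - Hb d1) / Cmarg (margW1 W)) ∧
      (lrRatioLe d1 d2 (Cmarg (margW1 W) / Cmarg (margW2 W)) →
        IsLeast {κ : ℝ | 0 ≤ κ ∧ CBSBC d1 d2 ⊆ scaleSet κ (Cap1 W)}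
          ((1 - Hb d2) / Cmarg (margW2 W)) ∧
        max ((1 - Hb d1) / Cmarg (margW1 W)) ((1 - Hb d2) / Cmarg (margW2 W))
          = (1 - Hb d2) / Cmarg (margW2 W))) ∧
    (d2 ≤ d1 →
      ((1 - 2*d2)^2 / (1 - 2*d1)^2 ≥ Cmarg (margW2 W) / Cmarg (margW1 W) →
        IsLeast {κ : ℝ | 0 ≤ κ ∧ CBSBC d1 d2 ⊆ scaleSet κ (Cap2 W)}
          ((1 - Hb d2) / Cmarg (margW2 W)) ∧
        max ((1 - Hb d1) / Cmarg (margW1 W)) ((1 - Hb d2) / Cmarg (margW2 W))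
          = (1 - Hb d2) / Cmarg (margW2 W)) ∧
      (lrRatioLe d2 d1 (Cmarg (margW2 W) / Cmarg (margW1 W)) →
        IsLeast {κ : ℝ | 0 ≤ κ ∧ CBSBC d1 d2 ⊆ scaleSet κ (Cap2 W)}
          ((1 - Hb d1) / Cmarg (margW1 W)) ∧
        max ((1 - Hb d1) / Cmarg (margW1 W)) ((1 - Hb d2) / Cmarg (margW2 W))
          = (1 - Hb d1) / Cmarg (margW1 W))) := by
  have ht : ∀ R : ℝ × ℝ, 0 ≤ R.1 → 0 ≤ R.2 →
      R.1 / Cmarg (margW1 W) + R.2 / Cmarg (margW2 W) ≤ 1 → R ∈ Cap W :=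
    fun R h1 h2 h => cap_triangle W hW hC1 hC2 R h1 h2 h
  have ht1 : ∀ R : ℝ × ℝ, 0 ≤ R.1 → 0 ≤ R.2 →
      R.1 / Cmarg (margW1 W) + R.2 / Cmarg (margW2 W) ≤ 1 → R ∈ Cap1 W :=
    fun R h1 h2 h => closure_mono (fun R hR => ach1_of_ach0 W R hR) (ht R h1 h2 h)
  have ht2 : ∀ R : ℝ × ℝ, 0 ≤ R.1 → 0 ≤ R.2 →
      R.1 / Cmarg (margW1 W) + R.2 / Cmarg (margW2 W) ≤ 1 → R ∈ Cap2 W :=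
    fun R h1 h2 h => closure_mono (fun R hR => ach2_of_ach0 W R hR) (ht R h1 h2 h)
  have hb1 : ∀ R ∈ Cap1 W, R.1 ≤ Cmarg (margW1 W) ∧ R.2 ≤ Cmarg (margW2 W) :=
    fun R hR => cap1_le W hW hC1 hC2 R hR
  have hb2 : ∀ R ∈ Cap2 W, R.1 ≤ Cmarg (margW1 W) ∧ R.2 ≤ Cmarg (margW2 W) :=
    fun R hR => cap2_le W hW hC1 hC2 R hR
  refine ⟨fun hd => ⟨fun hc => ?_, fun hc => ?_⟩, fun hd => ⟨fun hc => ?_, fun hc => ?_⟩⟩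
  · refine least_aux _ _ _ d1 d2 _ hC1 hC2 hd11 hd21 ht1 hb1 (Or.inl rfl) fun α hα => ?_
    have h := ratio_le_aux hC1 hC2 (ent1 d1 d2 _ hd10 hd hd21 hc α hα).1
    refine (add_le_add le_rfl h).trans (le_of_eq ?_)
    ring
  · refine least_aux _ _ _ d1 d2 _ hC1 hC2 hd11 hd21 ht1 hb1 (Or.inr rfl) fun α hα => ?_
    have h := ratio_ge_aux hC1 hC2 (ent2 d1 d2 _ hd10 hd hd21 hc α hα).2
    refine (add_le_add h le_rfl).trans (le_of_eq ?_)
    ring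
  · refine least_aux _ _ _ d1 d2 _ hC1 hC2 hd11 hd21 ht2 hb2 (Or.inr rfl) fun α hα => ?_
    have h := ratio_le_aux hC2 hC1 (ent1 d2 d1 _ hd20 hd hd11 hc α hα).2
    refine (add_le_add h le_rfl).trans (le_of_eq ?_)
    ring
  · refine least_aux _ _ _ d1 d2 _ hC1 hC2 hd11 hd21 ht2 hb2 (Or.inl rfl) fun α hα => ?_
    have h := ratio_ge_aux hC2 hC1 (ent2 d2 d1 _ hd20 hd hd11 hc α hα).1
    refine (add_le_add le_rfl h).trans (le_of_eq ?_)
    ring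

end
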